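/- arXiv:2302.02634 — 6 statements merged into one kernel-verified Lean document; each statement's English description precedes it below -/
import Mathlib

section
/- For all integers N ≥ 1 and d ≥ 1, the ℂ-vector space V_d^Diff of differentially homogeneous polynomials of degree d in the variables X_0, …, X_N is finite-dimensional, of dimension exactly (N+1)^d. (Schmidt–Kolchin conjecture.) -/
open MvPolynomial

/-- The algebra homomorphism `φ_Q` sending `X_i^{(k)}` to
`∑_{j=0}^{k} (k choose j) · Q^{(k−j)} · X_i^{(j)}`, where `Q^{(m)}` is the `m`-th formal
derivative of `Q` acting as a scalar in the coefficient ring `Polynomial ℂ`. -/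
noncomputable def phi (N : ℕ) (Q : Polynomial ℂ) :
    MvPolynomial (Fin (N + 1) × ℕ) ℂ →ₐ[ℂ] MvPolynomial (Fin (N + 1) × ℕ) (Polynomial ℂ) :=
  aeval fun p => ∑ j ∈ Finset.range (p.2 + 1),
    C ((p.2.choose j : Polynomial ℂ) * (Polynomial.derivative^[p.2 - j] Q)) * X (p.1, j)

/-- Coefficient-ring extension `ι : V → MvPolynomial _ (Polynomial ℂ)` along `ℂ → Polynomial ℂ`. -/
noncomputable def iota (N : ℕ) :
    MvPolynomial (Fin (N + 1) × ℕ) ℂ →ₐ[ℂ] MvPolynomial (Fin (N + 1) × ℕ) (Polynomial ℂ) :=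
  mapAlgHom (Algebra.ofId ℂ (Polynomial ℂ))

/-- `P` is differentially homogeneous of degree `d`. -/
def IsDiffHom (N d : ℕ) (P : MvPolynomial (Fin (N + 1) × ℕ) ℂ) : Prop :=
  ∀ Q : Polynomial ℂ, phi N Q P = C (Q ^ d) * iota N P

/-- The ℂ-subspace `V_d^Diff` of differentially homogeneous polynomials of degree `d`. -/
noncomputable def VDiff (N d : ℕ) : Submodule ℂ (MvPolynomial (Fin (N + 1) × ℕ) ℂ) where
  carrier := {P | IsDiffHom N d P}
  add_mem' := by
    intro a b ha hb Q
    rw [map_add, ha Q, hb Q, map_add, mul_add]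
  zero_mem' := by intro Q; simp
  smul_mem' := by
    intro c x hx Q
    rw [map_smul, hx Q, map_smul, mul_smul_comm]


namespace MvPolynomial
variable {R : Type*} [CommRing R] {d : ℕ} {Λ : Type*} [CommRing Λ]
  [Algebra Λ (MvPolynomial (Fin d) R)]

variable (R d Λ) in
/-- The `Λ`-algebra generated by the first `k` variables. -/
noncomputable def symAdjoin (k : ℕ) : Subalgebra Λ (MvPolynomial (Fin d) R) :=
  Algebra.adjoin _ (X '' {j : Fin d | (j : ℕ) < k})

lemma symAdjoin_self
    (hΛ : ∀ p : MvPolynomial (Fin d) R, p.IsSymmetric ↔ ∃ a : Λ, algebraMap _ _ a = p) :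
    symAdjoin R d Λ d = ⊤ := by
  have h : {j : Fin d | (j : ℕ) < d} = Set.univ := by ext; simp
  rw [symAdjoin, h, Set.image_univ, eq_top_iff]
  rintro p -
  induction p using MvPolynomial.induction_on with
  | C a =>
    obtain ⟨b, hb⟩ := (hΛ (C a)).1 (IsSymmetric.C a)
    exact hb ▸ Subalgebra.algebraMap_mem _ b
  | add p q hp hq => exact add_mem hp hq
  | mul_X p i hp => exact mul_mem hp (Algebra.subset_adjoin ⟨i, rfl⟩)

lemma X_mem_symAdjoin {k : ℕ} {j : Fin d} (h : (j : ℕ) < k) :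
    (X j : MvPolynomial (Fin d) R) ∈ symAdjoin R d Λ k :=
  Algebra.subset_adjoin ⟨j, h, rfl⟩

lemma symAdjoin_mono {k l : ℕ} (h : k ≤ l) : symAdjoin R d Λ k ≤ symAdjoin R d Λ l :=
  Algebra.adjoin_mono (Set.image_mono fun _ hj => lt_of_lt_of_le hj h)

lemma rename_symAdjoin
    (hΛ : ∀ p : MvPolynomial (Fin d) R, p.IsSymmetric ↔ ∃ a : Λ, algebraMap _ _ a = p)
    {k : ℕ} {σ : Equiv.Perm (Fin d)} (hσ : ∀ j : Fin d, (j : ℕ) < k → σ j = j)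
    {p : MvPolynomial (Fin d) R} (hp : p ∈ symAdjoin R d Λ k) : rename σ p = p := by
  induction hp using Algebra.adjoin_induction with
  | mem x hx => obtain ⟨j, hj, rfl⟩ := hx; rw [rename_X, hσ j hj]
  | algebraMap r => exact (hΛ _).2 ⟨r, rfl⟩ σ
  | add p q _ _ hp hq => rw [map_add, hp, hq]
  | mul p q _ _ hp hq => rw [map_mul, hp, hq]

lemma card_filter_le_val (k : ℕ) :
    (Finset.univ.filter fun j : Fin d => k ≤ (j : ℕ)).card = d - k := by
  have h := Finset.card_filter_add_card_filter_not (s := (Finset.univ : Finset (Fin d)))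
    (fun j => (j : ℕ) < k)
  simp only [not_lt, Finset.card_univ, Fintype.card_fin] at h
  rw [Fin.card_filter_val_lt] at h
  omega

variable (R d) in
/-- The monic polynomial whose roots are the variables from the `k`-th one on. -/
noncomputable def tailPoly (k : ℕ) : Polynomial (MvPolynomial (Fin d) R) :=
  ∏ j ∈ Finset.univ.filter fun j : Fin d => k ≤ (j : ℕ), (Polynomial.X - Polynomial.C (X j))

lemma tailPoly_monic (k : ℕ) : (tailPoly R d k).Monic :=
  Polynomial.monic_prod_of_monic _ _ fun _ _ => Polynomial.monic_X_sub_C _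

lemma natDegree_tailPoly [Nontrivial R] (k : ℕ) : (tailPoly R d k).natDegree = d - k := by
  rw [tailPoly, Polynomial.natDegree_prod_of_monic _ _ fun _ _ => Polynomial.monic_X_sub_C _]
  simp [card_filter_le_val]

lemma tailPoly_succ {k : ℕ} (hk : k < d) :
    tailPoly R d k = (Polynomial.X - Polynomial.C (X ⟨k, hk⟩)) * tailPoly R d (k + 1) := by
  have : (Finset.univ.filter fun j : Fin d => k ≤ (j : ℕ)) =
      insert ⟨k, hk⟩ (Finset.univ.filter fun j : Fin d => k + 1 ≤ (j : ℕ)) := by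
    ext j; simp [Fin.ext_iff]; omega
  rw [tailPoly, this, Finset.prod_insert (by simp)]; rfl

lemma tailPoly_mem_lifts
    (hΛ : ∀ p : MvPolynomial (Fin d) R, p.IsSymmetric ↔ ∃ a : Λ, algebraMap _ _ a = p)
    {k : ℕ} (hk : k ≤ d) :
    tailPoly R d k ∈ Polynomial.lifts (algebraMap (symAdjoin R d Λ k) (MvPolynomial (Fin d) R)) := by
  induction k with
  | zero =>
    rw [Polynomial.lifts_iff_coeff_lifts]
    intro n
    have hs : ((tailPoly R d 0).coeff n).IsSymmetric := by
      intro σ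
      have h : (tailPoly R d 0).map (rename σ : MvPolynomial (Fin d) R →ₐ[R] _).toRingHom =
          tailPoly R d 0 := by
        simp only [tailPoly, Polynomial.map_prod, Nat.zero_le, Finset.filter_true]
        simpa using Equiv.prod_comp σ fun i =>
          (Polynomial.X - Polynomial.C (X i : MvPolynomial (Fin d) R))
      conv_rhs => rw [← h, Polynomial.coeff_map]
      rfl
    obtain ⟨b, hb⟩ := (hΛ _).1 hs
    exact ⟨⟨_, Subalgebra.algebraMap_mem _ b⟩, hb⟩
  | succ k ih =>
    rw [Nat.succ_le_iff] at hk
    have h := ih hk.le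
    have hle := symAdjoin_mono (R := R) (d := d) (Λ := Λ) k.le_succ
    rw [Polynomial.mem_lifts] at h ⊢
    obtain ⟨q, hq⟩ := h
    refine ⟨(q.map (Subalgebra.inclusion hle).toRingHom) /ₘ
      (Polynomial.X - Polynomial.C ⟨X ⟨k, hk⟩, X_mem_symAdjoin k.lt_succ_self⟩), ?_⟩
    rw [Polynomial.map_divByMonic _ (Polynomial.monic_X_sub_C _), Polynomial.map_map]
    have e : (algebraMap (symAdjoin R d Λ (k + 1)) (MvPolynomial (Fin d) R)).comp
      (Subalgebra.inclusion hle).toRingHom = algebraMap (symAdjoin R d Λ k) _ := rfl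
    rw [e, hq, tailPoly_succ hk]
    simp only [Polynomial.map_sub, Polynomial.map_X, Polynomial.map_C]
    exact Polynomial.mul_divByMonic_cancel_left _ (Polynomial.monic_X_sub_C _)

variable [IsDomain R]

theorem symAdjoin_free_finite [FaithfulSMul Λ (MvPolynomial (Fin d) R)]
    (hΛ : ∀ p : MvPolynomial (Fin d) R, p.IsSymmetric ↔ ∃ a : Λ, algebraMap _ _ a = p)
    {k : ℕ} (hk : k ≤ d) :
    Module.Free Λ (symAdjoin R d Λ k) ∧ Module.Finite Λ (symAdjoin R d Λ k) := by
  induction k with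
  | zero =>
    have h : symAdjoin R d Λ 0 = ⊥ := by simp [symAdjoin]
    rw [h]
    have e := (Algebra.botEquivOfInjective (R := Λ)
      (A := MvPolynomial (Fin d) R) (FaithfulSMul.algebraMap_injective _ _)).toLinearEquiv
    exact ⟨Module.Free.of_equiv e.symm, Module.Finite.equiv e.symm⟩
  | succ k ih =>
    rw [Nat.succ_le_iff] at hk
    classical
    obtain ⟨hfree, hfin⟩ := ih hk.le
    set B := symAdjoin R d Λ k
    let x : MvPolynomial (Fin d) R := X ⟨k, hk⟩
    let F : (Fin (d - k) → B) →ₗ[Λ] MvPolynomial (Fin d) R :=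
      ∑ i : Fin (d - k), (LinearMap.mulRight Λ (x ^ (i : ℕ))) ∘ₗ B.val.toLinearMap ∘ₗ LinearMap.proj i
    have hF : ∀ c, F c = ∑ i, (c i : MvPolynomial (Fin d) R) * x ^ (i : ℕ) := by
      intro c; simp [F, LinearMap.sum_apply]
    have hinj : Function.Injective F := by
      rw [← LinearMap.ker_eq_bot, LinearMap.ker_eq_bot']
      intro c hc
      rw [hF] at hc
      let p : Polynomial (MvPolynomial (Fin d) R) :=
        ∑ i : Fin (d - k), Polynomial.C (c i : MvPolynomial (Fin d) R) * Polynomial.X ^ (i : ℕ)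
      have hp : p = 0 := by
        refine Polynomial.eq_zero_of_degree_lt_of_eval_finset_eq_zero
          ((Finset.univ.filter fun j : Fin d => k ≤ (j : ℕ)).image X) ?_ ?_
        · rw [Finset.card_image_of_injective _ (X_injective), card_filter_le_val]
          refine (Polynomial.degree_sum_fin_lt _)
        · intro y hy
          simp only [Finset.mem_image, Finset.mem_filter, Finset.mem_univ, true_and] at hy
          obtain ⟨j, hj, rfl⟩ := hy
          have := congrArg (rename (Equiv.swap (⟨k, hk⟩ : Fin d) j)) hc
          rw [map_zero, map_sum] at this
          rw [← this]
          simp only [p, Polynomial.eval_finsetSum, Polynomial.eval_mul, Polynomial.eval_C,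
            Polynomial.eval_pow, Polynomial.eval_X, map_mul, map_pow, x, rename_X,
            Equiv.swap_apply_left]
          refine Finset.sum_congr rfl fun i _ => ?_
          rw [rename_symAdjoin hΛ (k := k) _ (c i).2]
          intro l hl
          refine Equiv.swap_apply_of_ne_of_ne ?_ ?_ <;> rintro rfl
          · simp at hl
          · omega
      ext i : 2
      have := congrArg (fun q => Polynomial.coeff q (i : ℕ)) hp
      simpa [p, Polynomial.finsetSum_coeff, Polynomial.coeff_C_mul, Polynomial.coeff_X_pow,
        Fin.val_inj] using this
    have hrange : LinearMap.range F = Subalgebra.toSubmodule (symAdjoin R d Λ (k + 1)) := by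
      apply le_antisymm
      · rintro _ ⟨c, rfl⟩
        rw [hF]
        exact Subalgebra.sum_mem _ fun i _ => mul_mem (symAdjoin_mono k.le_succ (c i).2)
          (pow_mem (X_mem_symAdjoin k.lt_succ_self) _)
      · have h1 : symAdjoin R d Λ (k + 1) ≤
            ((Polynomial.aeval (R := B) x).restrictScalars Λ).range := by
          refine Algebra.adjoin_le ?_
          rintro _ ⟨j, hj, rfl⟩
          rcases Nat.lt_succ_iff_lt_or_eq.1 hj with h | h
          · exact ⟨Polynomial.C ⟨X j, X_mem_symAdjoin h⟩, by simp⟩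
          · exact ⟨Polynomial.X, by simp [x, ← h]⟩
        intro y hy
        obtain ⟨p, rfl⟩ := h1 hy
        obtain ⟨f, hf, hdeg, hmon⟩ := Polynomial.lifts_and_natDegree_eq_and_monic
          (tailPoly_mem_lifts hΛ hk.le) (tailPoly_monic k)
        rw [natDegree_tailPoly] at hdeg
        refine ⟨fun i => (p %ₘ f).coeff i, ?_⟩
        have h0 : Polynomial.aeval x f = 0 := by
          rw [Polynomial.aeval_def, ← Polynomial.eval_map, hf, tailPoly_succ hk]
          simp [x]
        have h2 : Polynomial.aeval x p = Polynomial.aeval x (p %ₘ f) := by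
          conv_lhs => rw [← Polynomial.modByMonic_add_div p f]
          simp [h0]
        have h3 : (p %ₘ f).natDegree < d - k := by
          rw [← hdeg]; refine Polynomial.natDegree_modByMonic_lt _ hmon ?_
          rintro rfl; simp at hdeg; omega
        rw [hF]
        change _ = Polynomial.aeval x p
        rw [h2, Polynomial.aeval_eq_sum_range' h3, Finset.sum_range]
        rfl
    have e := (LinearEquiv.ofInjective F hinj).trans (LinearEquiv.ofEq _ _ hrange)
    exact ⟨Module.Free.of_equiv e, Module.Finite.equiv e⟩

theorem free_finite_of_isSymmetric_iff [FaithfulSMul Λ (MvPolynomial (Fin d) R)]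
    (hΛ : ∀ p : MvPolynomial (Fin d) R, p.IsSymmetric ↔ ∃ a : Λ, algebraMap _ _ a = p) :
    Module.Free Λ (MvPolynomial (Fin d) R) ∧ Module.Finite Λ (MvPolynomial (Fin d) R) := by
  obtain ⟨h1, h2⟩ := symAdjoin_free_finite hΛ le_rfl
  rw [symAdjoin_self hΛ] at h1 h2
  exact ⟨Module.Free.of_equiv Subalgebra.topEquiv.toLinearEquiv,
    Module.Finite.equiv Subalgebra.topEquiv.toLinearEquiv⟩

end MvPolynomial

open scoped TensorProduct

theorem LinearMap.trace_algEquiv_eq_zero {A B : Type*} [CommRing A] [CommRing B] [IsDomain B]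
    [Algebra A B] [FaithfulSMul A B] [Module.Free A B] [Module.Finite A B] (g : B ≃ₐ[A] B)
    (hg : g ≠ 1) : LinearMap.trace A B g.toLinearMap = 0 := by
  have : IsDomain A := (FaithfulSMul.algebraMap_injective A B).isDomain _
  obtain ⟨x, hx⟩ : ∃ x, g x ≠ x := by
    by_contra! h
    exact hg (AlgEquiv.ext h)
  have key : ∀ y, LinearMap.trace A B (g.toLinearMap * LinearMap.mulLeft A ((x - g x) * y)) = 0 := by
    intro y
    have h1 : g.toLinearMap * LinearMap.mulLeft A (x * y) =
        LinearMap.mulLeft A (g x) * (g.toLinearMap * LinearMap.mulLeft A y) := by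
      ext z; simp
    have h2 : g.toLinearMap * LinearMap.mulLeft A (g x * y) =
        (g.toLinearMap * LinearMap.mulLeft A y) * LinearMap.mulLeft A (g x) := by
      ext z; simp; ring
    have h3 : g.toLinearMap * LinearMap.mulLeft A ((x - g x) * y) =
        g.toLinearMap * LinearMap.mulLeft A (x * y) -
        g.toLinearMap * LinearMap.mulLeft A (g x * y) := by
      ext z; simp [sub_mul, mul_assoc]
    rw [h3, map_sub, h1, h2, LinearMap.trace_mul_comm, sub_self]
  obtain ⟨a, ha, y, hy⟩ := (Algebra.IsAlgebraic.isAlgebraic (R := A) (x - g x)).exists_nonzero_dvd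
    (mem_nonZeroDivisors_of_ne_zero (sub_ne_zero.2 hx.symm))
  have h := key y
  rw [← hy] at h
  have h4 : g.toLinearMap * LinearMap.mulLeft A (algebraMap A B a) = a • g.toLinearMap := by
    ext z; simp [Algebra.smul_def]
  rw [h4, map_smul, smul_eq_mul] at h
  exact (mul_eq_zero.1 h).resolve_left ha

namespace MvPolynomial

variable {d : ℕ}

instance symmetricSubalgebra_free :
    Module.Free (symmetricSubalgebra (Fin d) ℂ) (MvPolynomial (Fin d) ℂ) :=
  (free_finite_of_isSymmetric_iff fun _ => ⟨fun h => ⟨⟨_, h⟩, rfl⟩, fun ⟨a, ha⟩ => ha ▸ a.2⟩).1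

instance symmetricSubalgebra_finite :
    Module.Finite (symmetricSubalgebra (Fin d) ℂ) (MvPolynomial (Fin d) ℂ) :=
  (free_finite_of_isSymmetric_iff fun _ => ⟨fun h => ⟨⟨_, h⟩, rfl⟩, fun ⟨a, ha⟩ => ha ▸ a.2⟩).2

noncomputable instance symmetricSubalgebraAugmentation :
    Algebra (symmetricSubalgebra (Fin d) ℂ) ℂ :=
  ((constantCoeff : MvPolynomial (Fin d) ℂ →+* ℂ).comp
    (symmetricSubalgebra (Fin d) ℂ).val.toRingHom).toAlgebra

lemma symmetricSubalgebra_smul (a : symmetricSubalgebra (Fin d) ℂ) (z : ℂ) :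
    a • z = constantCoeff (a : MvPolynomial (Fin d) ℂ) * z := rfl

/-- Permutation of variables, as an automorphism over the symmetric polynomials. -/
noncomputable def permEquiv (σ : Equiv.Perm (Fin d)) :
    MvPolynomial (Fin d) ℂ ≃ₐ[symmetricSubalgebra (Fin d) ℂ] MvPolynomial (Fin d) ℂ :=
  { renameEquiv ℂ σ with commutes' := fun a => a.2 σ }

@[simp]
lemma permEquiv_apply (σ : Equiv.Perm (Fin d)) (p : MvPolynomial (Fin d) ℂ) :
    permEquiv σ p = rename σ p := rfl

variable (d) in
/-- The algebra of coinvariants of the symmetric group. -/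
abbrev Coinv : Type := ℂ ⊗[symmetricSubalgebra (Fin d) ℂ] MvPolynomial (Fin d) ℂ

variable (d) in
/-- The action of the symmetric group on the coinvariant algebra. -/
noncomputable def coinvRep : Representation ℂ (Equiv.Perm (Fin d)) (Coinv d) where
  toFun σ := (permEquiv σ).toLinearMap.baseChange ℂ
  map_one' := by
    ext p; simp
  map_mul' σ τ := by
    ext p; simp [rename_rename]

lemma coinvRep_tmul (σ : Equiv.Perm (Fin d)) (z : ℂ) (p : MvPolynomial (Fin d) ℂ) :
    coinvRep d σ (z ⊗ₜ p) = z ⊗ₜ rename σ p := rfl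

lemma trace_coinvRep {σ : Equiv.Perm (Fin d)} (hσ : σ ≠ 1) :
    (coinvRep d).character σ = 0 := by
  change LinearMap.trace ℂ _ ((permEquiv σ).toLinearMap.baseChange ℂ) = 0
  rw [LinearMap.trace_baseChange, LinearMap.trace_algEquiv_eq_zero, map_zero]
  intro h
  refine hσ (Equiv.ext fun i => ?_)
  have := AlgEquiv.congr_fun h (X i)
  simpa using this

lemma exists_eq_one_tmul (x : Coinv d) : ∃ p : MvPolynomial (Fin d) ℂ, x = (1 : ℂ) ⊗ₜ p := by
  induction x using TensorProduct.induction_on with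
  | zero => exact ⟨0, by simp⟩
  | tmul z p =>
    refine ⟨C z * p, ?_⟩
    have h : C z * p = (⟨C z, IsSymmetric.C z⟩ : symmetricSubalgebra (Fin d) ℂ) • p := rfl
    rw [h, TensorProduct.tmul_smul, TensorProduct.smul_tmul', symmetricSubalgebra_smul]
    simp
  | add x y hx hy =>
    obtain ⟨p, rfl⟩ := hx
    obtain ⟨q, rfl⟩ := hy
    exact ⟨p + q, (TensorProduct.tmul_add _ _ _).symm⟩

lemma one_tmul_symmetric {p : MvPolynomial (Fin d) ℂ} (hp : p.IsSymmetric) :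
    ((1 : ℂ) ⊗ₜ p : Coinv d) = constantCoeff p • (1 : ℂ) ⊗ₜ 1 := by
  have h : p = (⟨p, hp⟩ : symmetricSubalgebra (Fin d) ℂ) • (1 : MvPolynomial (Fin d) ℂ) :=
    (mul_one p).symm
  conv_lhs => rw [h]
  rw [TensorProduct.tmul_smul, TensorProduct.smul_tmul', symmetricSubalgebra_smul,
    TensorProduct.smul_tmul']
  rfl

lemma finrank_coinvRep_invariants : Module.finrank ℂ (coinvRep d).invariants = 1 := by
  have hne : ((1 : ℂ) ⊗ₜ 1 : Coinv d) ≠ 0 := by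
    intro h0
    have hp : 0 < Module.finrank ℂ (Coinv d) := by
      rw [Module.finrank_baseChange]
      exact Module.finrank_pos
    have := Module.nontrivial_of_finrank_pos hp
    exact one_ne_zero (α := Coinv d) h0
  refine _root_.finrank_eq_one (⟨(1 : ℂ) ⊗ₜ 1, fun σ => by rw [coinvRep_tmul, map_one]⟩) ?_ ?_
  · exact fun h => hne (congrArg Subtype.val h)
  · rintro ⟨x, hx⟩
    obtain ⟨p, rfl⟩ := exists_eq_one_tmul x
    let q : MvPolynomial (Fin d) ℂ := ∑ σ : Equiv.Perm (Fin d), rename σ p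
    have hq : q.IsSymmetric := by
      intro τ
      simp only [q, map_sum, rename_rename]
      exact Equiv.sum_comp (Equiv.mulLeft τ) fun σ : Equiv.Perm (Fin d) => rename σ p
    have h : (Fintype.card (Equiv.Perm (Fin d)) : ℂ) • ((1 : ℂ) ⊗ₜ p : Coinv d) =
        (1 : ℂ) ⊗ₜ q := by
      simp only [q, TensorProduct.tmul_sum]
      rw [Finset.sum_congr rfl fun σ _ => ((coinvRep_tmul σ 1 p).symm.trans (hx σ))]
      simp [Nat.cast_smul_eq_nsmul]
    refine ⟨(Fintype.card (Equiv.Perm (Fin d)) : ℂ)⁻¹ * constantCoeff q, Subtype.ext ?_⟩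
    rw [one_tmul_symmetric hq] at h
    simp only [Submodule.coe_smul, mul_smul, ← h]
    rw [inv_smul_smul₀]
    exact_mod_cast Fintype.card_ne_zero

lemma finrank_coinv : Module.finrank ℂ (Coinv d) = Fintype.card (Equiv.Perm (Fin d)) := by
  have hc : (Nat.card (Equiv.Perm (Fin d)) : ℂ) ≠ 0 := by
    exact_mod_cast Nat.card_pos.ne'
  have : Invertible (Nat.card (Equiv.Perm (Fin d)) : ℂ) := invertibleOfNonzero hc
  have h := (coinvRep d).card_inv_mul_sum_char_eq_finrank
  rw [finrank_coinvRep_invariants, Finset.sum_eq_single 1 (fun σ _ hσ => trace_coinvRep hσ)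
    (by simp), Representation.char_one, inv_mul_eq_iff_eq_mul₀ hc, Nat.cast_one, mul_one,
    Nat.card_eq_fintype_card] at h
  exact_mod_cast h

variable (d) in
/-- The action of the symmetric group on functions on words of length `d`. -/
def wordRep (α : Type*) : Representation ℂ (Equiv.Perm (Fin d)) ((Fin d → α) → ℂ) where
  toFun σ := LinearMap.funLeft ℂ ℂ fun w => w ∘ σ
  map_one' := rfl
  map_mul' _ _ := rfl

lemma wordRep_apply {α : Type*} (σ : Equiv.Perm (Fin d)) (f : (Fin d → α) → ℂ) (w : Fin d → α) :
    wordRep d α σ f w = f (w ∘ σ) := rfl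

theorem finrank_linHom_invariants (α : Type*) [Fintype α] :
    Module.finrank ℂ (Representation.linHom (coinvRep d) (wordRep d α)).invariants =
      Fintype.card α ^ d := by
  classical
  have hc : (Nat.card (Equiv.Perm (Fin d)) : ℂ) ≠ 0 := by
    exact_mod_cast Nat.card_pos.ne'
  have : Invertible (Nat.card (Equiv.Perm (Fin d)) : ℂ) := invertibleOfNonzero hc
  have h := (Representation.linHom (coinvRep d) (wordRep d α)).card_inv_mul_sum_char_eq_finrank
  simp only [Representation.char_linHom] at h
  rw [Finset.sum_eq_single 1 (fun σ _ hσ => by rw [trace_coinvRep (inv_ne_one.2 hσ), zero_mul])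
    (by simp), inv_one, Representation.char_one, Representation.char_one, finrank_coinv,
    ← Nat.card_eq_fintype_card, inv_mul_cancel_left₀ hc] at h
  simpa using (by exact_mod_cast h.symm : _ = Module.finrank ℂ ((Fin d → α) → ℂ))

/-- Families of linear forms, indexed by words of length `d`, which factor through the
coinvariant algebra and are compatible with the action of the symmetric group. -/
noncomputable def symForms (d : ℕ) (α : Type*) :
    Submodule ℂ ((Fin d → α) → MvPolynomial (Fin d) ℂ →ₗ[ℂ] ℂ) where
  carrier := {L | (∀ w (a p : MvPolynomial (Fin d) ℂ), a.IsSymmetric →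
      L w (a * p) = constantCoeff a * L w p) ∧
    ∀ w (σ : Equiv.Perm (Fin d)) p, L w (rename σ p) = L (w ∘ σ) p}
  add_mem' := by
    rintro L M ⟨h1, h2⟩ ⟨h3, h4⟩
    exact ⟨fun w a p ha => by simp [h1 w a p ha, h3 w a p ha, mul_add],
      fun w σ p => by simp [h2, h4]⟩
  zero_mem' := by simp
  smul_mem' := by
    rintro c L ⟨h1, h2⟩
    exact ⟨fun w a p ha => by simp [h1 w a p ha, mul_left_comm], fun w σ p => by simp [h2]⟩

/-- A compatible family of linear forms amounts to an equivariant map out of the coinvariants. -/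
noncomputable def invariantsEquivSymForms (d : ℕ) (α : Type*) :
    (Representation.linHom (coinvRep d) (wordRep d α)).invariants ≃ₗ[ℂ] symForms d α := by
  let F : (Representation.linHom (coinvRep d) (wordRep d α)).invariants →ₗ[ℂ] symForms d α :=
    { toFun T := ⟨fun w =>
        { toFun p := T.1 ((1 : ℂ) ⊗ₜ p) w
          map_add' p q := by rw [TensorProduct.tmul_add, map_add, Pi.add_apply]
          map_smul' z p := by
            have h : z • p = (⟨C z, IsSymmetric.C z⟩ : symmetricSubalgebra (Fin d) ℂ) • p :=
              smul_eq_C_mul _ _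
            rw [h, TensorProduct.tmul_smul, TensorProduct.smul_tmul', symmetricSubalgebra_smul,
              constantCoeff_C, ← smul_eq_mul, ← TensorProduct.smul_tmul', map_smul]
            rfl }, by
        refine ⟨fun w a p ha => ?_, fun w σ p => ?_⟩
        · change T.1 ((1 : ℂ) ⊗ₜ (a * p)) w = constantCoeff a * T.1 ((1 : ℂ) ⊗ₜ p) w
          have h : a * p = (⟨a, ha⟩ : symmetricSubalgebra (Fin d) ℂ) • p := rfl
          rw [h, TensorProduct.tmul_smul, TensorProduct.smul_tmul', symmetricSubalgebra_smul,
            ← smul_eq_mul, ← TensorProduct.smul_tmul', map_smul]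
          rfl
        · have h := (Representation.mem_linHom_invariants_iff_isIntertwining T.1).1 T.2
          exact congrFun (h.isIntertwining σ ((1 : ℂ) ⊗ₜ p)) w⟩
      map_add' _ _ := rfl
      map_smul' _ _ := rfl }
  have hF : ∀ T w p, (F T).1 w p = T.1 ((1 : ℂ) ⊗ₜ p) w := fun _ _ _ => rfl
  refine LinearEquiv.ofBijective F ⟨fun T T' h => ?_, fun L => ?_⟩
  · refine Subtype.ext (LinearMap.ext fun x => ?_)
    obtain ⟨p, rfl⟩ := exists_eq_one_tmul x
    ext w
    rw [← hF, ← hF, h]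
  · let g : MvPolynomial (Fin d) ℂ →ₗ[symmetricSubalgebra (Fin d) ℂ] ((Fin d → α) → ℂ) :=
      { toFun p w := L.1 w p
        map_add' p q := by ext; simp
        map_smul' a p := by
          ext w
          exact L.2.1 w a p a.2 }
    refine ⟨⟨g.liftBaseChange ℂ,
      (Representation.mem_linHom_invariants_iff_isIntertwining _).2 ⟨fun σ x => ?_⟩⟩, ?_⟩
    · obtain ⟨p, rfl⟩ := exists_eq_one_tmul x
      ext w
      rw [wordRep_apply, coinvRep_tmul, LinearMap.liftBaseChange_tmul,
        LinearMap.liftBaseChange_tmul, one_smul, one_smul]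
      exact L.2.2 w σ p
    · apply Subtype.ext
      funext w
      refine LinearMap.ext fun p => ?_
      rw [hF]
      simp [g]

theorem finiteDimensional_symForms (d : ℕ) (α : Type*) [Fintype α] :
    FiniteDimensional ℂ (symForms d α) :=
  Module.Finite.equiv (invariantsEquivSymForms d α)

theorem finrank_symForms (d : ℕ) (α : Type*) [Fintype α] :
    Module.finrank ℂ (symForms d α) = Fintype.card α ^ d := by
  rw [← (invariantsEquivSymForms d α).finrank_eq, finrank_linHom_invariants]

end MvPolynomial
namespace MvPolynomial
open Finset

variable {α : Type*}

/-- The value at a point of the substitution `φ_Q`, where `q` is the Taylor expansion of `Q`. -/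
noncomputable def psi (α : Type*) (q : Polynomial ℂ) :
    MvPolynomial (α × ℕ) ℂ →ₐ[ℂ] MvPolynomial (α × ℕ) ℂ :=
  aeval fun a => ∑ j ∈ range (a.2 + 1),
    C ((a.2.factorial : ℂ) / j.factorial * q.coeff (a.2 - j)) * X (a.1, j)

lemma psi_X (q : Polynomial ℂ) (a : α × ℕ) : psi α q (X a) = ∑ j ∈ range (a.2 + 1),
    C ((a.2.factorial : ℂ) / j.factorial * q.coeff (a.2 - j)) * X (a.1, j) := aeval_X _ _

lemma map_phi (N : ℕ) (Q : Polynomial ℂ) (s : ℂ) (P : MvPolynomial (Fin (N + 1) × ℕ) ℂ) :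
    map (Polynomial.evalRingHom s) (phi N Q P) = psi _ (Polynomial.taylor s Q) P := by
  induction P using MvPolynomial.induction_on with
  | C a =>
    rw [← algebraMap_eq, AlgHom.commutes, AlgHom.commutes]
    simp [algebraMap_apply]
  | add p q hp hq => simp only [map_add, hp, hq]
  | mul_X p a hp =>
    rw [map_mul, map_mul, map_mul, hp, psi_X, phi, aeval_X, map_sum]
    congr 1
    refine sum_congr rfl fun j hj => ?_
    have hj : j ≤ a.2 := by simpa [Nat.lt_succ_iff] using hj
    rw [map_mul, map_C, map_X, map_mul, map_natCast, Polynomial.taylor_coeff,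
      ← Polynomial.factorial_smul_hasseDeriv, Nat.cast_choose ℂ hj]
    congr 2
    simp only [Polynomial.coe_evalRingHom, LinearMap.smul_apply, Polynomial.eval_smul]
    have h1 : (j.factorial : ℂ) ≠ 0 := by exact_mod_cast j.factorial_ne_zero
    have h2 : ((a.2 - j).factorial : ℂ) ≠ 0 := by exact_mod_cast (a.2 - j).factorial_ne_zero
    simp only [nsmul_eq_mul]
    field_simp

lemma map_iota (N : ℕ) (s : ℂ) (P : MvPolynomial (Fin (N + 1) × ℕ) ℂ) :
    map (Polynomial.evalRingHom s) (iota N P) = P := by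
  rw [iota]
  change map _ (map _ P) = P
  rw [map_map]
  convert map_id P
  ext x
  simp

lemma isDiffHom_iff {N d : ℕ} {P : MvPolynomial (Fin (N + 1) × ℕ) ℂ} :
    IsDiffHom N d P ↔ ∀ q, psi _ q P = C (q.coeff 0 ^ d) * P := by
  constructor
  · intro h q
    have := congrArg (map (Polynomial.evalRingHom 0)) (h q)
    rwa [map_phi, map_mul, map_iota, map_C, Polynomial.taylor_zero, map_pow,
      Polynomial.coe_evalRingHom, ← Polynomial.coeff_zero_eq_eval_zero] at this
  · intro h Q
    ext1 m
    refine Polynomial.funext fun s => ?_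
    have := congrArg (coeff m) (h (Polynomial.taylor s Q))
    rw [← map_phi, ← congrArg (C _ * ·) (map_iota N s P), coeff_map, coeff_C_mul, coeff_map] at this
    rw [coeff_C_mul, Polynomial.eval_mul]
    simpa using this

/-- The derivation pairing the variables `X_i^{(k)}` with the coefficients of `p`. -/
noncomputable def pairDer [DecidableEq α] (i : α) :
    Polynomial ℂ →ₗ[ℂ] Module.End ℂ (MvPolynomial (α × ℕ) ℂ) where
  toFun p := (mkDerivation ℂ fun a : α × ℕ =>
    (C (if a.1 = i then a.2.factorial * p.coeff a.2 else 0) : MvPolynomial (α × ℕ) ℂ)).toLinearMap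
  map_add' p q := by
    rw [← Derivation.coe_add_linearMap]
    congr 1
    ext a
    simp only [mkDerivation_X, Derivation.add_apply, ← C_add]
    split_ifs <;> simp [mul_add]
  map_smul' c p := by
    rw [RingHom.id_apply, ← Derivation.coe_smul_linearMap]
    congr 1
    ext a
    simp only [mkDerivation_X, Derivation.smul_apply, smul_eq_C_mul, ← C_mul]
    split_ifs <;> simp [mul_left_comm]

lemma constantCoeff_psi (q : Polynomial ℂ) (f : MvPolynomial (α × ℕ) ℂ) :
    constantCoeff (psi α q f) = constantCoeff f := by
  induction f using MvPolynomial.induction_on with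
  | C a => rw [← algebraMap_eq, AlgHom.commutes]
  | add f g hf hg => simp only [map_add, hf, hg]
  | mul_X f a hf => simp [psi_X]

section
variable [DecidableEq α]

lemma pairDer_X (i : α) (p : Polynomial ℂ) (a : α × ℕ) :
    pairDer i p (X a) = C (if a.1 = i then a.2.factorial * p.coeff a.2 else 0) :=
  mkDerivation_X ..

lemma pairDer_C (i : α) (p : Polynomial ℂ) (c : ℂ) : pairDer i p (C c) = 0 :=
  derivation_C _ c

lemma pairDer_mul (i : α) (p : Polynomial ℂ) (f g : MvPolynomial (α × ℕ) ℂ) :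
    pairDer i p (f * g) = f * pairDer i p g + g * pairDer i p f :=
  Derivation.leibniz _ _ _

lemma pairDer_psi (i : α) (p q : Polynomial ℂ) (f : MvPolynomial (α × ℕ) ℂ) :
    pairDer i p (psi α q f) = psi α q (pairDer i (q * p) f) := by
  induction f using MvPolynomial.induction_on with
  | C a => rw [← algebraMap_eq, AlgHom.commutes, algebraMap_eq, pairDer_C, pairDer_C, map_zero]
  | add f g hf hg => simp only [map_add, hf, hg]
  | mul_X f a hf =>
    rw [map_mul (psi α q), pairDer_mul, pairDer_mul, map_add, map_mul (psi α q),
      map_mul (psi α q), hf]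
    congr 2
    rw [pairDer_X, ← algebraMap_eq, AlgHom.commutes, psi_X, map_sum, algebraMap_eq]
    simp only [pairDer_mul, pairDer_C, pairDer_X, mul_zero, add_zero, ← C_mul]
    rw [← map_sum]
    congr 1
    split_ifs
    · rw [mul_comm q p, Polynomial.coeff_mul, Nat.sum_antidiagonal_eq_sum_range_succ
        (fun k l => p.coeff k * q.coeff l), mul_sum]
      refine sum_congr rfl fun j _ => ?_
      have h1 : (j.factorial : ℂ) ≠ 0 := by exact_mod_cast j.factorial_ne_zero
      field_simp
    · simp

lemma pairDer_X_pow (i : α) (k : ℕ) (f : MvPolynomial (α × ℕ) ℂ) :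
    pairDer i (Polynomial.X ^ k) f = C (k.factorial : ℂ) * pderiv (i, k) f := by
  have : pairDer i (Polynomial.X ^ k) =
      ((k.factorial : ℂ) • pderiv (R := ℂ) (i, k)).toLinearMap := by
    change Derivation.toLinearMap _ = _
    congr 1
    ext1 a
    rw [mkDerivation_X, Derivation.smul_apply, pderiv_X, smul_eq_C_mul, Polynomial.coeff_X_pow]
    obtain ⟨j, l⟩ := a
    by_cases h1 : j = i <;> by_cases h2 : l = k <;> simp [h1, h2]
  rw [this, ← smul_eq_C_mul]
  rfl

end
end MvPolynomial

namespace MvPolynomial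
open Finset

section
variable {α : Type*} [DecidableEq α]

/-- The product of the derivations `pairDer` along a list. -/
noncomputable def pairList (l : List (α × Polynomial ℂ)) :
    Module.End ℂ (MvPolynomial (α × ℕ) ℂ) :=
  (l.map fun x => pairDer x.1 x.2).prod

lemma pairList_psi (q : Polynomial ℂ) (l : List (α × Polynomial ℂ))
    (f : MvPolynomial (α × ℕ) ℂ) :
    pairList l (psi α q f) = psi α q (pairList (l.map fun x => (x.1, q * x.2)) f) := by
  induction l generalizing f with
  | nil => simp [pairList]
  | cons x l ih =>
    have h := ih f
    simp only [pairList, List.map_cons, List.prod_cons, Module.End.mul_apply] at h ⊢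
    rw [h, pairDer_psi]

/-- The product of the factorials of the exponents of a monomial. -/
noncomputable def facWeight (m : α × ℕ →₀ ℕ) : ℂ := m.prod fun _ k => (k.factorial : ℂ)

lemma facWeight_add_single (m : α × ℕ →₀ ℕ) (a : α × ℕ) :
    facWeight (m + Finsupp.single a 1) = (m a + 1) * facWeight m := by
  classical
  set s := insert a (m.support ∪ (m + Finsupp.single a 1).support) with hs
  have h1 : facWeight m = ∏ x ∈ s, ((m x).factorial : ℂ) :=
    Finsupp.prod_of_support_subset _ (by intro x hx; simp only [hs, mem_insert, mem_union]; tauto)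
      _ (by simp)
  have h2 : facWeight (m + Finsupp.single a 1) =
      ∏ x ∈ s, (((m + Finsupp.single a 1 : α × ℕ →₀ ℕ) x).factorial : ℂ) :=
    Finsupp.prod_of_support_subset _ (by intro x hx; simp only [hs, mem_insert, mem_union]; tauto)
      _ (by simp)
  have ha : a ∈ s := by simp [hs]
  rw [h1, h2, ← mul_prod_erase s _ ha, ← mul_prod_erase s (fun x => ((m x).factorial : ℂ)) ha,
    ← mul_assoc]
  congr 1
  · simp [Nat.factorial_succ]
  · refine prod_congr rfl fun x hx => ?_
    rw [Finsupp.add_apply, Finsupp.single_eq_of_ne (ne_of_mem_erase hx), add_zero]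

omit [DecidableEq α] in
lemma facWeight_ne_zero (m : α × ℕ →₀ ℕ) : facWeight m ≠ 0 :=
  Finset.prod_ne_zero_iff.2 fun x _ => Nat.cast_ne_zero.2 (m x).factorial_ne_zero

lemma coeff_pairList (l : List (α × ℕ)) (m : α × ℕ →₀ ℕ) (f : MvPolynomial (α × ℕ) ℂ) :
    facWeight m * coeff m (pairList (l.map fun x => (x.1, Polynomial.X ^ x.2)) f) =
      (l.map fun x => (x.2.factorial : ℂ)).prod *
        (facWeight (m + (l.map fun x => Finsupp.single x 1).sum) *
          coeff (m + (l.map fun x => Finsupp.single x 1).sum) f) := by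
  induction l generalizing m with
  | nil => simp [pairList]
  | cons x l ih =>
    have h := ih (m + Finsupp.single x 1)
    simp only [pairList, List.map_cons, List.prod_cons, List.sum_cons, Module.End.mul_apply] at h ⊢
    rw [pairDer_X_pow, coeff_C_mul, coeff_pderiv, ← add_assoc, mul_assoc, ← h,
      facWeight_add_single]
    ring

/-- The multilinear form `p ↦ (∂_{w_1,p_1} ⋯ ∂_{w_d,p_d} f)(0)`. -/
noncomputable def formM {d : ℕ} (f : MvPolynomial (α × ℕ) ℂ) (w : Fin d → α) :
    MultilinearMap ℂ (fun _ : Fin d => Polynomial ℂ) ℂ :=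
  ((lcoeff ℂ (0 : α × ℕ →₀ ℕ)) ∘ₗ LinearMap.applyₗ f).compMultilinearMap
    ((MultilinearMap.mkPiAlgebraFin ℂ d (Module.End ℂ (MvPolynomial (α × ℕ) ℂ))).compLinearMap
      fun j => pairDer (w j))

lemma formM_apply {d : ℕ} (f : MvPolynomial (α × ℕ) ℂ) (w : Fin d → α)
    (p : Fin d → Polynomial ℂ) :
    formM f w p = coeff 0 (pairList (List.ofFn fun j => (w j, p j)) f) := by
  simp [formM, pairList, List.map_ofFn, Function.comp_def]

lemma formM_psi {d : ℕ} (q : Polynomial ℂ) (f : MvPolynomial (α × ℕ) ℂ) (w : Fin d → α)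
    (p : Fin d → Polynomial ℂ) :
    formM (psi α q f) w p = formM f w fun j => q * p j := by
  rw [formM_apply, pairList_psi, formM_apply, List.map_ofFn]
  exact constantCoeff_psi _ _

/-- The exponent vector of the monomial `∏ j, X (a j)`. -/
noncomputable def expVec {d : ℕ} (a : Fin d → α × ℕ) : α × ℕ →₀ ℕ := ∑ j, Finsupp.single (a j) 1

lemma formM_X_pow {d : ℕ} (f : MvPolynomial (α × ℕ) ℂ) (w : Fin d → α) (s : Fin d → ℕ) :
    formM f w (fun j => Polynomial.X ^ s j) = (∏ j, ((s j).factorial : ℂ)) *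
      (facWeight (expVec fun j => (w j, s j)) * coeff (expVec fun j => (w j, s j)) f) := by
  have := coeff_pairList (List.ofFn fun j => (w j, s j)) 0 f
  simp only [List.map_ofFn, Function.comp_def, List.prod_ofFn, List.sum_ofFn, zero_add] at this
  rw [formM_apply, expVec, ← this, facWeight, Finsupp.prod_zero_index, one_mul]

/-- The family of linear forms attached to `f`. -/
noncomputable def form (d : ℕ) :
    MvPolynomial (α × ℕ) ℂ →ₗ[ℂ] (Fin d → α) → MvPolynomial (Fin d) ℂ →ₗ[ℂ] ℂ where
  toFun f w := (basisMonomials (Fin d) ℂ).constr ℂ fun s => (∏ j, ((s j).factorial : ℂ)) *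
      (facWeight (expVec fun j => (w j, s j)) * coeff (expVec fun j => (w j, s j)) f)
  map_add' f g := by
    funext w
    rw [Pi.add_apply, ← map_add]
    congr 1
    funext s
    simp only [coeff_add, Pi.add_apply]
    ring
  map_smul' c f := by
    funext w
    rw [RingHom.id_apply, Pi.smul_apply, ← map_smul]
    congr 1
    funext s
    simp only [coeff_smul, Pi.smul_apply, smul_eq_mul]
    ring

omit [DecidableEq α] in
lemma form_monomial {d : ℕ} (f : MvPolynomial (α × ℕ) ℂ) (w : Fin d → α) (s : Fin d →₀ ℕ) :
    form d f w (monomial s 1) = (∏ j, ((s j).factorial : ℂ)) *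
      (facWeight (expVec fun j => (w j, s j)) * coeff (expVec fun j => (w j, s j)) f) := by
  have : monomial s (1 : ℂ) = basisMonomials (Fin d) ℂ s := by rw [coe_basisMonomials]
  rw [this]
  exact Module.Basis.constr_basis (basisMonomials (Fin d) ℂ) ℂ _ s

/-- `p ↦ ∏ j, p_j(X_j)` as a multilinear map. -/
noncomputable def prodAeval (d : ℕ) :
    MultilinearMap ℂ (fun _ : Fin d => Polynomial ℂ) (MvPolynomial (Fin d) ℂ) :=
  (MultilinearMap.mkPiAlgebra ℂ (Fin d) (MvPolynomial (Fin d) ℂ)).compLinearMap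
    fun j => (Polynomial.aeval (X j : MvPolynomial (Fin d) ℂ)).toLinearMap

lemma prodAeval_apply {d : ℕ} (p : Fin d → Polynomial ℂ) :
    prodAeval d p = ∏ j, Polynomial.aeval (X j : MvPolynomial (Fin d) ℂ) (p j) := by
  simp [prodAeval]

lemma prodAeval_X_pow {d : ℕ} (s : Fin d →₀ ℕ) :
    prodAeval d (fun j => Polynomial.X ^ s j) = monomial s 1 := by
  rw [prodAeval_apply, monomial_eq, C_1, one_mul, Finsupp.prod_fintype _ _ (by simp)]
  simp

lemma form_prodAeval {d : ℕ} (f : MvPolynomial (α × ℕ) ℂ) (w : Fin d → α)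
    (p : Fin d → Polynomial ℂ) : form d f w (prodAeval d p) = formM f w p := by
  suffices h : (form d f w).compMultilinearMap (prodAeval d) = formM f w from
    congrArg (fun M => M p) h
  refine Module.Basis.ext_multilinear (fun _ => Polynomial.basisMonomials ℂ) fun s => ?_
  simp only [Polynomial.coe_basisMonomials, Polynomial.monomial_one_right_eq_X_pow,
    LinearMap.compMultilinearMap_apply]
  rw [formM_X_pow]
  have := prodAeval_X_pow (Finsupp.equivFunOnFinite.symm s)
  simp only [Finsupp.equivFunOnFinite_symm_apply_apply] at this
  rw [this, form_monomial]
  simp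

end
end MvPolynomial

namespace MvPolynomial
open Finset

lemma linearMap_esymm_mul_eq_zero {d : ℕ} (L : MvPolynomial (Fin d) ℂ →ₗ[ℂ] ℂ)
    (h : ∀ q g, L (prodAeval d (fun _ => q) * g) = q.coeff 0 ^ d * L g)
    {k : ℕ} (hk : 0 < k) (g : MvPolynomial (Fin d) ℂ) : L (esymm (Fin d) ℂ k * g) = 0 := by
  rcases lt_or_ge d k with hd | hd
  · have : esymm (Fin d) ℂ k = 0 := by
      rw [esymm, powersetCard_eq_empty.2 (by simpa using hd), sum_empty]
    rw [this, zero_mul, map_zero]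
  have key : ∑ j ∈ range (d + 1), Polynomial.C (L (esymm (Fin d) ℂ j * g)) *
      (Polynomial.X ^ (d - j) : Polynomial ℂ) = Polynomial.C (L g) * Polynomial.X ^ d := by
    refine Polynomial.funext fun c => ?_
    have h1 := h (Polynomial.X + Polynomial.C c) g
    have h2 := congrArg (Polynomial.eval (C c)) (prod_C_add_X_eq_sum_esymm ℂ (Fin d))
    rw [Polynomial.eval_prod, Polynomial.eval_finsetSum] at h2
    have h3 : prodAeval d (fun _ => Polynomial.X + Polynomial.C c) =
        ∑ j ∈ range (d + 1), esymm (Fin d) ℂ j * C (c ^ (d - j)) := by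
      rw [prodAeval_apply]
      simpa [add_comm, algebraMap_eq] using h2
    rw [h3, sum_mul, map_sum] at h1
    simp only [Polynomial.coeff_add, Polynomial.coeff_X_zero, Polynomial.coeff_C_zero, zero_add]
      at h1
    rw [Polynomial.eval_finsetSum]
    simp only [Polynomial.eval_mul, Polynomial.eval_C, Polynomial.eval_pow, Polynomial.eval_X]
    rw [mul_comm (L g), ← h1]
    refine sum_congr rfl fun j _ => ?_
    rw [mul_right_comm, mul_comm _ (C _), ← smul_eq_C_mul, map_smul, smul_eq_mul, mul_comm]
  have := congrArg (fun p => Polynomial.coeff p (d - k)) key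
  simp only [Polynomial.finsetSum_coeff, Polynomial.coeff_C_mul_X_pow] at this
  rw [if_neg (by omega), sum_eq_single k, if_pos rfl] at this
  · exact this
  · intro j hj hjk
    rw [mem_range] at hj
    exact if_neg (by omega)
  · intro hk
    simp only [mem_range] at hk
    omega

lemma constantCoeff_esymm {d k : ℕ} (hk : 0 < k) : constantCoeff (esymm (Fin d) ℂ k) = 0 := by
  rw [esymm, map_sum]
  refine sum_eq_zero fun t ht => ?_
  obtain ⟨i, hi⟩ : t.Nonempty := card_pos.1 (by rw [(mem_powersetCard.1 ht).2]; exact hk)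
  rw [map_prod]
  exact prod_eq_zero hi (by simp)

lemma linearMap_symmetric_mul {d : ℕ} (L : MvPolynomial (Fin d) ℂ →ₗ[ℂ] ℂ)
    (h : ∀ q g, L (prodAeval d (fun _ => q) * g) = q.coeff 0 ^ d * L g)
    (a g : MvPolynomial (Fin d) ℂ) (ha : a.IsSymmetric) :
    L (a * g) = constantCoeff a * L g := by
  obtain ⟨b, hb⟩ := esymmAlgHom_fin_surjective ℂ (le_refl d) ⟨a, ha⟩
  have hb : aeval (fun i : Fin d => esymm (Fin d) ℂ (i + 1)) b = a := by
    rw [← esymmAlgHom_apply, hb]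
  rw [← hb]
  clear * - h
  induction b using MvPolynomial.induction_on generalizing g with
  | C c => rw [algHom_C, algebraMap_eq, ← smul_eq_C_mul, map_smul, constantCoeff_C, smul_eq_mul]
  | add p q hp hq => simp only [map_add, add_mul, hp, hq]
  | mul_X p i hp =>
    rw [map_mul (aeval _), aeval_X, map_mul constantCoeff, constantCoeff_esymm (Nat.succ_pos _),
      mul_zero, zero_mul, mul_comm _ (esymm _ _ _), mul_assoc,
      linearMap_esymm_mul_eq_zero L h (Nat.succ_pos _)]

lemma isSymmetric_prodAeval {d : ℕ} (q : Polynomial ℂ) :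
    (prodAeval d fun _ => q).IsSymmetric := by
  intro σ
  rw [prodAeval_apply, map_prod]
  simp only [← Polynomial.aeval_algHom_apply, rename_X]
  exact Equiv.prod_comp σ fun j => Polynomial.aeval (X j : MvPolynomial (Fin d) ℂ) q

lemma constantCoeff_prodAeval {d : ℕ} (q : Polynomial ℂ) :
    constantCoeff (prodAeval d fun _ => q) = q.coeff 0 ^ d := by
  have (j : Fin d) : constantCoeff (Polynomial.aeval (X j : MvPolynomial (Fin d) ℂ) q) =
      q.coeff 0 := by
    rw [Polynomial.aeval_def, Polynomial.hom_eval₂, constantCoeff_X, algebraMap_eq,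
      constantCoeff_comp_C, Polynomial.eval₂_id, Polynomial.coeff_zero_eq_eval_zero]
  rw [prodAeval_apply, map_prod]
  simp [this]

lemma symForms_eq_zero_of_le {d : ℕ} {α : Type*} {L : (Fin d → α) → MvPolynomial (Fin d) ℂ →ₗ[ℂ] ℂ}
    (hL : L ∈ symForms d α) (w : Fin d → α) (s : Fin d →₀ ℕ) {j : Fin d} (hj : d ≤ s j) :
    L w (monomial s 1) = 0 := by
  have h (q g) : L w (prodAeval d (fun _ => q) * g) = q.coeff 0 ^ d * L w g := by
    rw [hL.1 _ _ _ (isSymmetric_prodAeval q), constantCoeff_prodAeval]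
  have key (g) : L w (X j ^ d * g) = 0 := by
    have h2 := congrArg (Polynomial.eval (-X j)) (prod_C_add_X_eq_sum_esymm ℂ (Fin d))
    rw [Polynomial.eval_prod, Polynomial.eval_finsetSum, prod_eq_zero (mem_univ j) (by simp),
      Fintype.card_fin, sum_range_succ'] at h2
    have h3 := congrArg (fun p => L w (p * g)) h2
    simp only [zero_mul, map_zero, add_mul, map_add, sum_mul, map_sum, Polynomial.eval_mul,
      Polynomial.eval_C, mul_assoc, linearMap_esymm_mul_eq_zero (L w) h (Nat.succ_pos _),
      sum_const_zero, zero_add, esymm_zero, one_mul, Polynomial.eval_pow, Polynomial.eval_X,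
      Nat.sub_zero] at h3
    rw [neg_pow, ← map_one (C (σ := Fin d) (R := ℂ)), ← map_neg, ← map_pow, mul_assoc,
      ← smul_eq_C_mul, map_smul, smul_eq_mul] at h3
    exact (mul_eq_zero.1 h3.symm).resolve_left (pow_ne_zero _ (by norm_num))
  have : monomial s (1 : ℂ) = X j ^ d * monomial (s - Finsupp.single j d) 1 := by
    rw [X_pow_eq_monomial, monomial_mul, one_mul, add_tsub_cancel_of_le]
    rwa [Finsupp.single_le_iff]
  rw [this, key]

section
variable {α : Type*} [DecidableEq α] {d : ℕ}

lemma form_psi (q : Polynomial ℂ) (f : MvPolynomial (α × ℕ) ℂ) (w : Fin d → α)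
    (g : MvPolynomial (Fin d) ℂ) :
    form d (psi α q f) w g = form d f w (prodAeval d (fun _ => q) * g) := by
  suffices h : form d (psi α q f) w =
      form d f w ∘ₗ LinearMap.mulLeft ℂ (prodAeval d (fun _ => q)) from congrArg (· g) h
  refine (basisMonomials (Fin d) ℂ).ext fun s => ?_
  rw [coe_basisMonomials, LinearMap.comp_apply, LinearMap.mulLeft_apply]
  beta_reduce
  rw [← prodAeval_X_pow,
    form_prodAeval, formM_psi, ← form_prodAeval]
  congr 1
  simp only [prodAeval_apply, map_mul, prod_mul_distrib]

omit [DecidableEq α] in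
lemma form_rename (f : MvPolynomial (α × ℕ) ℂ) (w : Fin d → α) (σ : Equiv.Perm (Fin d))
    (g : MvPolynomial (Fin d) ℂ) : form d f w (rename σ g) = form d f (w ∘ σ) g := by
  suffices h : form d f w ∘ₗ (rename σ).toLinearMap = form d f (w ∘ σ) from congrArg (· g) h
  refine (basisMonomials (Fin d) ℂ).ext fun s => ?_
  rw [coe_basisMonomials, LinearMap.comp_apply, AlgHom.toLinearMap_apply, rename_monomial,
    form_monomial, form_monomial, ← Equiv.prod_comp σ]
  have h1 (j) : s.mapDomain σ (σ j) = s j := Finsupp.mapDomain_apply σ.injective s j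
  have h2 : (expVec fun j => (w j, s.mapDomain σ j)) = expVec fun j => ((w ∘ σ) j, s j) := by
    rw [expVec, ← Equiv.sum_comp σ]
    simp only [h1, expVec, Function.comp_apply]
  simp only [h1, h2]

omit [DecidableEq α] in
lemma psi_C_monomial (c : ℂ) (m : α × ℕ →₀ ℕ) (a : ℂ) :
    psi α (Polynomial.C c) (monomial m a) = monomial m (c ^ m.degree * a) := by
  have (x : α × ℕ) : psi α (Polynomial.C c) (X x) = C c * X x := by
    rw [psi_X, sum_range_succ, sum_eq_zero, zero_add]
    · simp [Nat.factorial_ne_zero]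
    · intro j hj
      rw [Polynomial.coeff_C_of_ne_zero (by have := mem_range.1 hj; omega), mul_zero, C_0, zero_mul]
  induction m using Finsupp.induction_linear generalizing a with
  | zero => simp [← algebraMap_eq]
  | add f g hf hg =>
    rw [← one_mul a, ← monomial_mul, map_mul, hf, hg, monomial_mul, map_add, pow_add]
    congr 1
    ring
  | single x k =>
    rw [← C_mul_X_pow_eq_monomial, map_mul, map_pow, this, ← algebraMap_eq, AlgHom.commutes,
      algebraMap_eq, mul_pow, ← map_pow, ← mul_assoc, ← C_mul, C_mul_X_pow_eq_monomial]
    simp [mul_comm]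

lemma coeff_psi_C (c : ℂ) (m : α × ℕ →₀ ℕ) (f : MvPolynomial (α × ℕ) ℂ) :
    coeff m (psi α (Polynomial.C c) f) = c ^ m.degree * coeff m f := by
  induction f using MvPolynomial.monomial_add_induction_on with
  | C a =>
    rw [← monomial_zero', psi_C_monomial, coeff_monomial, coeff_monomial]
    split_ifs with h
    · rw [h]
    · rw [mul_zero]
  | monomial_add a b f _ _ h =>
    rw [map_add, coeff_add, h, psi_C_monomial, coeff_monomial, coeff_add, coeff_monomial, mul_add]
    split_ifs with h
    · rw [h]
    · rw [mul_zero]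

omit [DecidableEq α] in
lemma exists_expVec_eq {m : α × ℕ →₀ ℕ} (hm : m.degree = d) :
    ∃ a : Fin d → α × ℕ, expVec a = m := by
  induction d generalizing m with
  | zero =>
    rw [Finsupp.degree_eq_zero_iff] at hm
    exact ⟨Fin.elim0, by simp [expVec, hm]⟩
  | succ d ih =>
    obtain ⟨x, hx⟩ : ∃ x, m x ≠ 0 := by
      by_contra! h
      have : m = 0 := Finsupp.ext h
      simp [this] at hm
    have hm' : m = Finsupp.single x 1 + (m - Finsupp.single x 1) := by
      rw [add_tsub_cancel_of_le]
      rw [Finsupp.single_le_iff]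
      omega
    obtain ⟨a, ha⟩ := ih (m := m - Finsupp.single x 1) (by
      rw [hm', map_add, Finsupp.degree_single] at hm
      omega)
    refine ⟨Fin.cons x a, ?_⟩
    rw [expVec, Fin.sum_univ_succ, Fin.cons_zero, hm', ← ha]
    simp [expVec]

omit [DecidableEq α] in
lemma degree_expVec (a : Fin d → α × ℕ) : (expVec a).degree = d := by
  simp [expVec]

lemma expVec_apply (a : Fin d → α × ℕ) (x : α × ℕ) : expVec a x = #{j | a j = x} := by
  rw [expVec, Finsupp.finsetSum_apply, card_filter]
  exact sum_congr rfl fun j _ => by rw [Finsupp.single_apply]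

lemma exists_perm_of_expVec_eq {a b : Fin d → α × ℕ} (h : expVec a = expVec b) :
    ∃ σ : Equiv.Perm (Fin d), b ∘ σ = a := by
  have e (x : α × ℕ) : Nonempty ({j // a j = x} ≃ {j // b j = x}) := by
    rw [← Fintype.card_eq, Fintype.card_subtype, Fintype.card_subtype, ← expVec_apply, h,
      expVec_apply]
  refine ⟨Equiv.ofFiberEquiv fun x => (e x).some, ?_⟩
  funext j
  exact Equiv.ofFiberEquiv_map (fun x => (e x).some) j

omit [DecidableEq α] in
lemma eq_zero_of_form_eq_zero {f : MvPolynomial (α × ℕ) ℂ} (hf : f.IsHomogeneous d)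
    (h : form d f = 0) : f = 0 := by
  ext m
  by_cases hm : m.degree = d
  · obtain ⟨a, rfl⟩ := exists_expVec_eq hm
    have := form_monomial f (fun j => (a j).1)
      (Finsupp.equivFunOnFinite.symm fun j => (a j).2)
    rw [h, Pi.zero_apply, LinearMap.zero_apply, zero_eq_mul, prod_eq_zero_iff] at this
    simpa [Nat.factorial_ne_zero, facWeight_ne_zero] using this
  · rw [hf.coeff_eq_zero hm, coeff_zero]

lemma exists_form_eq [Fintype α] {L : (Fin d → α) → MvPolynomial (Fin d) ℂ →ₗ[ℂ] ℂ}
    (hL : L ∈ symForms d α) :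
    ∃ f : MvPolynomial (α × ℕ) ℂ, f.IsHomogeneous d ∧ form d f = L := by
  classical
  let v (a : Fin d → α × ℕ) : ℂ := (L (fun j => (a j).1)
    (monomial (Finsupp.equivFunOnFinite.symm fun j => (a j).2) 1)) /
      ∏ j, ((a j).2.factorial : ℂ)
  have hv (a : Fin d → α × ℕ) (σ : Equiv.Perm (Fin d)) : v (a ∘ σ) = v a := by
    simp only [v]
    congr 1
    · have := hL.2 (fun j => (a j).1) σ
        (monomial (Finsupp.equivFunOnFinite.symm fun j => (a (σ j)).2) 1)
      have hm : (Finsupp.equivFunOnFinite.symm fun j => (a (σ j)).2).mapDomain σ =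
          Finsupp.equivFunOnFinite.symm fun j => (a j).2 := by
        refine Finsupp.ext fun j => ?_
        obtain ⟨j, rfl⟩ := σ.surjective j
        rw [Finsupp.mapDomain_apply σ.injective]
        rfl
      rw [rename_monomial, hm] at this
      exact this.symm
    · exact Equiv.prod_comp σ fun j => ((a j).2.factorial : ℂ)
  let S : Finset (α × ℕ →₀ ℕ) :=
    (Fintype.piFinset fun _ : Fin d => (univ : Finset α) ×ˢ range d).image expVec
  let c (m : α × ℕ →₀ ℕ) : ℂ := if h : ∃ a : Fin d → α × ℕ, expVec a = m then v h.choose else 0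
  have hc (a : Fin d → α × ℕ) : c (expVec a) = v a := by
    have h : ∃ b : Fin d → α × ℕ, expVec b = expVec a := ⟨a, rfl⟩
    obtain ⟨σ, hσ⟩ := exists_perm_of_expVec_eq h.choose_spec
    simp only [c, dif_pos h]
    rw [← hσ, hv]
  have hv0 (a : Fin d → α × ℕ) (ha : expVec a ∉ S) : v a = 0 := by
    have : ∃ j, d ≤ (a j).2 := by
      by_contra! h
      exact ha (mem_image_of_mem _ (by simpa using h))
    obtain ⟨j, hj⟩ := this
    simp only [v]
    rw [symForms_eq_zero_of_le hL _ _ (j := j) (by simpa using hj), zero_div]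
  refine ⟨∑ m ∈ S, monomial m (c m / facWeight m), ?_, ?_⟩
  · refine IsHomogeneous.sum _ _ _ fun m hm => isHomogeneous_monomial _ ?_
    obtain ⟨a, -, rfl⟩ := mem_image.1 hm
    exact degree_expVec a
  · funext w
    refine (basisMonomials (Fin d) ℂ).ext fun s => ?_
    rw [coe_basisMonomials]
    beta_reduce
    have hcoeff : coeff (expVec fun j => (w j, s j))
        (∑ m ∈ S, monomial m (c m / facWeight m)) =
        v (fun j => (w j, s j)) / facWeight (expVec fun j => (w j, s j)) := by
      simp only [coeff_sum, coeff_monomial, sum_ite_eq']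
      split_ifs with h
      · rw [hc]
      · rw [hv0 _ h, zero_div]
    have h1 : ∏ j, ((s j).factorial : ℂ) ≠ 0 :=
      prod_ne_zero_iff.2 fun j _ => Nat.cast_ne_zero.2 (s j).factorial_ne_zero
    have hs : (Finsupp.equivFunOnFinite.symm fun j => s j) = s := Finsupp.ext fun _ => rfl
    rw [form_monomial, hcoeff, mul_div_cancel₀ _ (facWeight_ne_zero _)]
    simp only [v, hs]
    rw [mul_div_cancel₀ _ h1]

end

section
variable {N d : ℕ} {P : MvPolynomial (Fin (N + 1) × ℕ) ℂ}

lemma isHomogeneous_of_isDiffHom (hP : IsDiffHom N d P) : P.IsHomogeneous d := by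
  intro m hm
  have h := coeff_psi_C 2 m P
  rw [isDiffHom_iff.1 hP, Polynomial.coeff_C_zero, coeff_C_mul] at h
  have h2 : ((2 ^ d : ℕ) : ℂ) = (2 ^ m.degree : ℕ) := by exact_mod_cast mul_right_cancel₀ hm h
  have h3 := Nat.pow_right_injective le_rfl (Nat.cast_injective h2)
  rw [h3, Finsupp.degree_eq_weight_one]
  rfl

lemma form_mem_symForms (hP : IsDiffHom N d P) : form d P ∈ symForms d (Fin (N + 1)) := by
  refine ⟨fun w a p ha => linearMap_symmetric_mul _ (fun q g => ?_) a p ha,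
    fun w σ p => form_rename P w σ p⟩
  rw [← form_psi, isDiffHom_iff.1 hP, ← smul_eq_C_mul, map_smul]
  rfl

lemma isDiffHom_of_form_mem (hP : P.IsHomogeneous d) (h : form d P ∈ symForms d (Fin (N + 1))) :
    IsDiffHom N d P := by
  refine isDiffHom_iff.2 fun q => sub_eq_zero.1 (eq_zero_of_form_eq_zero (d := d) ?_ ?_)
  · refine IsHomogeneous.sub ?_ (hP.C_mul _)
    have := hP.aeval (R := ℂ) (n := 1) (fun a : Fin (N + 1) × ℕ => ∑ j ∈ range (a.2 + 1),
      C ((a.2.factorial : ℂ) / j.factorial * q.coeff (a.2 - j)) * X (a.1, j))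
      fun a => IsHomogeneous.sum _ _ _ fun j _ => isHomogeneous_C_mul_X _ _
    rwa [one_mul] at this
  · funext w
    rw [map_sub, ← smul_eq_C_mul, map_smul]
    refine LinearMap.ext fun g => ?_
    simp only [Pi.sub_apply, Pi.smul_apply, LinearMap.sub_apply, LinearMap.smul_apply, form_psi,
      h.1 _ _ _ (isSymmetric_prodAeval q), constantCoeff_prodAeval, smul_eq_mul, sub_self,
      Pi.zero_apply, LinearMap.zero_apply]

variable (N d) in
/-- Differentially homogeneous polynomials correspond to symmetric families of linear forms. -/
noncomputable def vDiffEquivSymForms : VDiff N d ≃ₗ[ℂ] symForms d (Fin (N + 1)) :=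
  LinearEquiv.ofBijective
    ((form d).restrict (p := VDiff N d) (q := symForms d (Fin (N + 1)))
      fun _ hP => form_mem_symForms hP) <| by
    constructor
    · rw [← LinearMap.ker_eq_bot, LinearMap.ker_eq_bot']
      rintro ⟨P, hP⟩ h
      exact Subtype.ext
        (eq_zero_of_form_eq_zero (isHomogeneous_of_isDiffHom hP) (congrArg Subtype.val h))
    · rintro ⟨L, hL⟩
      obtain ⟨P, hP, rfl⟩ := exists_form_eq hL
      exact ⟨⟨P, isDiffHom_of_form_mem hP hL⟩, rfl⟩

end
end MvPolynomial

/-- **Schmidt–Kolchin conjecture**: `V_d^Diff` is finite-dimensional of dimension `(N+1)^d`. -/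
theorem schmidt_kolchin (N d : ℕ) (hN : 1 ≤ N) (hd : 1 ≤ d) :
    FiniteDimensional ℂ (VDiff N d) ∧
      Module.finrank ℂ (VDiff N d) = (N + 1) ^ d := by
  have e := vDiffEquivSymForms N d
  have := finiteDimensional_symForms d (Fin (N + 1))
  exact ⟨e.symm.finiteDimensional, by rw [e.finrank_eq, finrank_symForms, Fintype.card_fin]⟩
end

section
/- For all integers N ≥ 1 and d ≥ 1, every differentially homogeneous polynomial of degree d has order at most d−1; that is, every variable X_i^{(j)} occurring in it with nonzero coefficient satisfies j ≤ d−1. -/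
open MvPolynomial

/-- The substitution `X_i^{(k)} ↦ s X_i^{(k)} - k X_i^{(k-1)}` with formal parameter `s`: this is
`φ_Q` for `Q = s - T`, evaluated at `T = 0`. -/
noncomputable def shiftHom (ι : Type*) :
    MvPolynomial (ι × ℕ) ℂ →ₐ[ℂ] MvPolynomial (ι × ℕ) (Polynomial ℂ) :=
  aeval fun p => C Polynomial.X * X p - C (p.2 : Polynomial ℂ) * X (p.1, p.2 - 1)

theorem shiftHom_X {ι : Type*} (p : ι × ℕ) :
    shiftHom ι (X p) = C Polynomial.X * X p - C (p.2 : Polynomial ℂ) * X (p.1, p.2 - 1) :=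
  aeval_X _ _

theorem pderiv_shiftHom {ι : Type*} (i : ι) (k : ℕ) (P : MvPolynomial (ι × ℕ) ℂ) :
    pderiv (i, k) (shiftHom ι P) = C Polynomial.X * shiftHom ι (pderiv (i, k) P)
      - C ((k + 1 : ℕ) : Polynomial ℂ) * shiftHom ι (pderiv (i, k + 1) P) := by
  classical
  induction P using MvPolynomial.induction_on with
  | C a =>
    have h : shiftHom ι (C a) = C (Polynomial.C a) := aeval_C _ _
    simp [h]
  | add p q hp hq => simp only [map_add, hp, hq]; ring
  | mul_X p q hp =>
    have hX : pderiv (i, k) (shiftHom ι (X q)) =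
        C Polynomial.X * shiftHom ι (pderiv (i, k) (X q))
          - C ((k + 1 : ℕ) : Polynomial ℂ) * shiftHom ι (pderiv (i, k + 1) (X q)) := by
      obtain ⟨j, l⟩ := q
      rw [shiftHom_X, map_sub, pderiv_C_mul, pderiv_C_mul]
      simp only [pderiv_X, Pi.single_apply, Prod.mk.injEq]
      rcases l with _ | l
      · simp [apply_ite (shiftHom ι)]
      · by_cases hj : j = i <;> by_cases hl : l = k <;> simp [hj, hl, apply_ite (shiftHom ι)]
    rw [map_mul, pderiv_mul, hp, hX, pderiv_mul, pderiv_mul]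
    simp only [map_add, map_mul]
    ring

theorem map_eval_shiftHom (N : ℕ) (c : ℂ) (P : MvPolynomial (Fin (N + 1) × ℕ) ℂ) :
    map (Polynomial.evalRingHom c) (shiftHom (Fin (N + 1)) P) =
      map (Polynomial.evalRingHom 0) (phi N (Polynomial.C c - Polynomial.X) P) := by
  induction P using MvPolynomial.induction_on with
  | C a =>
    have h : shiftHom (Fin (N + 1)) (C a) = C (Polynomial.C a) := aeval_C _ _
    have h' : phi N (Polynomial.C c - Polynomial.X) (C a) = C (Polynomial.C a) := aeval_C _ _
    simp [h, h']
  | add p q hp hq => simp only [map_add, hp, hq]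
  | mul_X p q hp =>
    rw [map_mul, map_mul, hp, map_mul, map_mul, shiftHom_X]
    congr 1
    obtain ⟨j, l⟩ := q
    rw [phi, aeval_X]
    rcases l with _ | l
    · simp
    · rw [Finset.sum_range_succ, Finset.sum_range_succ, Finset.sum_eq_zero]
      · simp
        ring
      · intro m hm
        rw [Finset.mem_range] at hm
        rw [Polynomial.iterate_derivative_eq_zero]
        · simp
        · refine (Polynomial.natDegree_sub_le _ _).trans_lt ?_
          simp
          omega

/-- The infinitesimal version of differential homogeneity along `Q = s - T`, with `s` formal. -/
theorem IsDiffHom.shiftHom_eq {N d : ℕ} {P : MvPolynomial (Fin (N + 1) × ℕ) ℂ}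
    (hP : IsDiffHom N d P) :
    shiftHom (Fin (N + 1)) P = C (Polynomial.X ^ d) * map Polynomial.C P := by
  ext1 m
  refine Polynomial.funext fun c => ?_
  have h := congrArg (coeff m) (map_eval_shiftHom N c P)
  have hi : iota N P = map Polynomial.C P := rfl
  rw [hP, hi, coeff_map, coeff_map, coeff_C_mul, coeff_map] at h
  rw [coeff_C_mul, coeff_map]
  simpa [mul_comm (c ^ d)] using h

theorem eq_zero_of_X_mul_recurrence {d : ℕ} (hd : 1 ≤ d) {a : ℕ → Polynomial ℂ} {g : ℕ → ℂ}
    (h : ∀ k, Polynomial.X * a k - Polynomial.C (k + 1 : ℂ) * a (k + 1) =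
      Polynomial.X ^ d * Polynomial.C (g k))
    {K : ℕ} (hK : ∀ k, K ≤ k → a k = 0) {k : ℕ} (hk : d ≤ k) : g k = 0 := by
  have h0 : ∀ k, (a (k + 1)).coeff 0 = 0 := fun k => by
    have := congrArg (Polynomial.coeff · 0) (h k)
    simp only [Polynomial.coeff_sub, Polynomial.coeff_X_mul_zero, Polynomial.coeff_C_mul,
      Polynomial.coeff_mul_C, Polynomial.coeff_X_pow, if_neg (by omega : 0 ≠ d), zero_mul,
      zero_sub, neg_eq_zero] at this
    exact (mul_eq_zero.mp this).resolve_left (Nat.cast_add_one_ne_zero k)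
  have hs : ∀ k m, (a k).coeff m - (k + 1) * (a (k + 1)).coeff (m + 1) =
      if m + 1 = d then g k else 0 := fun k m => by
    have := congrArg (Polynomial.coeff · (m + 1)) (h k)
    simpa only [Polynomial.coeff_sub, Polynomial.coeff_X_mul, Polynomial.coeff_C_mul,
      Polynomial.coeff_mul_C, Polynomial.coeff_X_pow, ite_mul, one_mul, zero_mul] using this
  have high : ∀ j k m, K ≤ k + j → d ≤ m → (a k).coeff m = 0 := fun j => by
    induction j with
    | zero => intro k m hk _; simp [hK k hk]
    | succ j ih =>
      intro k m hk hm
      have := hs k m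
      rwa [ih (k + 1) (m + 1) (by omega) (by omega), if_neg (by omega), mul_zero, sub_zero] at this
  have low : ∀ m k, m < d → m < k → (a k).coeff m = 0 := fun m => by
    induction m with
    | zero =>
      rintro (_ | k) _ hk
      · omega
      · exact h0 k
    | succ m ih =>
      rintro (_ | k) hm hk
      · omega
      · have := hs k m
        rw [ih k (by omega) (by omega), if_neg (by omega), zero_sub, neg_eq_zero] at this
        exact (mul_eq_zero.mp this).resolve_left (Nat.cast_add_one_ne_zero k)
  obtain ⟨e, rfl⟩ : ∃ e, d = e + 1 := ⟨d - 1, by omega⟩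
  have := hs k e
  rw [low e k (by omega) (by omega), high K (k + 1) (e + 1) (by omega) le_rfl, if_pos rfl] at this
  simpa using this.symm

theorem notMem_vars_of_pderiv_eq_zero {σ R : Type*} [CommRing R] [IsDomain R] [CharZero R]
    {P : MvPolynomial σ R} {i : σ} (h : pderiv i P = 0) : i ∉ P.vars := by
  rw [mem_vars_iff_mem_support]
  rintro ⟨m, hm, hi⟩
  have hi' : m i ≠ 0 := Finsupp.mem_support_iff.mp hi
  have := congrArg (coeff (m - Finsupp.single i 1)) h
  rw [coeff_pderiv, tsub_add_cancel_of_le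
    (Finsupp.single_le_iff.mpr (Nat.one_le_iff_ne_zero.mpr hi')), coeff_zero] at this
  rcases mul_eq_zero.mp this with h | h
  · exact mem_support_iff.mp hm h
  · exact Nat.cast_add_one_ne_zero (R := R) _ h

/-- Every differentially homogeneous polynomial of degree `d` has order at most `d − 1`:
every variable `X_i^{(j)}` occurring in it satisfies `j ≤ d − 1`. -/
theorem diffHom_order_le (N d : ℕ) (hN : 1 ≤ N) (hd : 1 ≤ d)
    (P : MvPolynomial (Fin (N + 1) × ℕ) ℂ) (hP : IsDiffHom N d P) :
    ∀ p ∈ P.vars, p.2 ≤ d - 1 := by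
  rintro ⟨i, k⟩ hk
  by_contra hlt
  refine notMem_vars_of_pderiv_eq_zero ?_ hk
  obtain ⟨K, hK⟩ : ∃ K, ∀ l, K ≤ l → pderiv (i, l) P = 0 := by
    refine ⟨P.vars.sup Prod.snd + 1, fun l hl => pderiv_eq_zero_of_notMem_vars fun hm => ?_⟩
    have : l ≤ P.vars.sup Prod.snd := Finset.le_sup (f := Prod.snd) hm
    omega
  ext1 m
  refine eq_zero_of_X_mul_recurrence hd
    (a := fun l => coeff m (shiftHom (Fin (N + 1)) (pderiv (i, l) P)))
    (g := fun l => coeff m (pderiv (i, l) P)) (K := K)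
    (fun l => ?_) (fun l hl => by simp [hK l hl]) (by simpa using by omega : d ≤ k)
  have h := congrArg (coeff m) (pderiv_shiftHom i l P)
  rw [hP.shiftHom_eq, pderiv_C_mul, pderiv_map, coeff_C_mul, coeff_map, coeff_sub, coeff_C_mul,
    coeff_C_mul] at h
  simpa using h.symm
end

section
/- For all integers N ≥ 1 and d ≥ 1, every differentially homogeneous polynomial of degree d is a ℂ-linear combination of the polynomials W_𝒫, where 𝒫 ranges over all Wronskian data of degree d; that is, V_d^Diff equals the ℂ-linear span of the family (W_𝒫)_𝒫. -/
open MvPolynomial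

/-- A Wronskian datum of degree `d` in variables indexed by `Fin (N+1)`.  It is encoded by the
nondecreasing list `n_1 ≤ … ≤ n_d` of indices (`i` repeated `m_i` times) together with the
concatenated tuple `(α_1, …, α_d)` of exponents; within each block `{s | n s = i}` the exponents
are strictly increasing and bounded by `m_0 + m_1 + … + m_i = #{t | n t ≤ i}`. -/
structure WronskDatum (N d : ℕ) where
  n : Fin d → Fin (N + 1)
  a : Fin d → ℕ
  mono : Monotone n
  strictOnBlocks : ∀ s t : Fin d, s < t → n s = n t → a s < a t
  bound : ∀ s : Fin d, a s < (Finset.univ.filter fun t => n t ≤ n s).card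

/-- The polynomial `W_𝒫`: the determinant of the `d × d` matrix whose entry in row `r` and
column `s` is `(r choose α_s) · (α_s)! · X_{n_s}^{(r − α_s)}` if `r ≥ α_s` and `0` otherwise. -/
noncomputable def Wpoly {N d : ℕ} (D : WronskDatum N d) : MvPolynomial (Fin (N + 1) × ℕ) ℂ :=
  Matrix.det (Matrix.of fun r s : Fin d =>
    if D.a s ≤ (r : ℕ) then
      (((r : ℕ).choose (D.a s) * (D.a s).factorial : ℕ) : ℂ) • X (D.n s, (r : ℕ) - D.a s)
    else 0)

/-! ### Constant coefficient differential operators -/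

section ApplyDiff

variable {σ : Type*}

theorem pderiv_mul_pderiv_comm (i j : σ) :
    ((pderiv i : Derivation ℂ (MvPolynomial σ ℂ) _) : Module.End ℂ (MvPolynomial σ ℂ)) *
      (pderiv j : Derivation ℂ (MvPolynomial σ ℂ) _) =
    ((pderiv j : Derivation ℂ (MvPolynomial σ ℂ) _) : Module.End ℂ (MvPolynomial σ ℂ)) *
      (pderiv i : Derivation ℂ (MvPolynomial σ ℂ) _) := by
  classical
  ext1 m
  ext k
  simp only [LinearMap.comp_apply, Module.End.mul_apply, Derivation.coeFn_coe, coeff_pderiv]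
  by_cases h : i = j
  · subst h; rfl
  · simp only [Finsupp.add_apply, Finsupp.single_apply, if_neg h, if_neg (Ne.symm h), add_zero]
    rw [add_right_comm]
    ring

variable (σ) in
/-- The commutative algebra of differential operators with constant coefficients. -/
noncomputable abbrev diffOps : Subalgebra ℂ (Module.End ℂ (MvPolynomial σ ℂ)) :=
  Algebra.adjoin ℂ (Set.range fun i : σ =>
    ((pderiv i : Derivation ℂ (MvPolynomial σ ℂ) _) : Module.End ℂ (MvPolynomial σ ℂ)))

instance : IsMulCommutative (diffOps σ) := by
  apply Algebra.isMulCommutative_adjoin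
  rintro _ ⟨i, rfl⟩ _ ⟨j, rfl⟩
  exact pderiv_mul_pderiv_comm i j

open scoped IsMulCommutative in
variable (σ) in
/-- The algebra homomorphism sending a polynomial `g` to the differential operator `g(∂)`. -/
noncomputable def applyDiff :
    MvPolynomial σ ℂ →ₐ[ℂ] Module.End ℂ (MvPolynomial σ ℂ) :=
  (diffOps σ).val.comp
    (aeval fun i => (⟨_, Algebra.subset_adjoin ⟨i, rfl⟩⟩ : diffOps σ))

open scoped IsMulCommutative in
theorem applyDiff_X (i : σ) (F : MvPolynomial σ ℂ) : applyDiff σ (X i) F = pderiv i F := by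
  simp [applyDiff]

theorem applyDiff_aeval_X_mul (i : σ) (q f : Polynomial ℂ) (G : MvPolynomial σ ℂ)
    (hG : pderiv i G = 0) :
    applyDiff σ (Polynomial.aeval (X i) q) (Polynomial.aeval (X i) f * G) =
      Polynomial.aeval (X i) (Polynomial.aeval Polynomial.derivative q f) * G := by
  induction q using Polynomial.induction_on generalizing f with
  | C a => simp [Module.algebraMap_end_apply]
  | add p q hp hq => simp only [map_add, LinearMap.add_apply, hp, hq, add_mul]
  | monomial n a ih =>
    rw [pow_succ, ← mul_assoc, map_mul (Polynomial.aeval (X i)), map_mul (applyDiff σ),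
      Module.End.mul_apply, map_mul (Polynomial.aeval Polynomial.derivative),
      Module.End.mul_apply, ← ih]
    congr 1
    rw [Polynomial.aeval_X, applyDiff_X, Polynomial.aeval_X, pderiv_mul, hG, mul_zero, add_zero]
    congr 1
    induction f using Polynomial.induction_on' with
    | add p q hp hq => simp only [map_add, hp, hq]
    | monomial n a =>
      rw [Polynomial.derivative_monomial, Polynomial.aeval_monomial, Polynomial.aeval_monomial,
        pderiv_mul, algebraMap_eq, pderiv_C, pderiv_pow, pderiv_X_self]
      simp
      ring

theorem applyDiff_prod_aeval_X [Fintype σ] (q f : σ → Polynomial ℂ) :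
    applyDiff σ (∏ i, Polynomial.aeval (X i) (q i)) (∏ i, Polynomial.aeval (X i) (f i)) =
      ∏ i, Polynomial.aeval (X i) (Polynomial.aeval Polynomial.derivative (q i) (f i)) := by
  classical
  suffices h : ∀ S : Finset σ,
      applyDiff σ (∏ i ∈ S, Polynomial.aeval (X i) (q i)) (∏ i, Polynomial.aeval (X i) (f i)) =
      ∏ i, Polynomial.aeval (X i)
        (if i ∈ S then Polynomial.aeval Polynomial.derivative (q i) (f i) else f i) by
    simpa using h Finset.univ
  intro S
  induction S using Finset.induction_on with
  | empty => simp
  | insert a S ha ih =>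
    rw [Finset.prod_insert ha, map_mul, Module.End.mul_apply, ih,
      ← Finset.mul_prod_erase _ _ (Finset.mem_univ a), applyDiff_aeval_X_mul,
      ← Finset.mul_prod_erase _ _ (Finset.mem_univ a)]
    · congr 1
      · simp [ha]
      · refine Finset.prod_congr rfl fun i hi => ?_
        simp [Finset.ne_of_mem_erase hi]
    · apply pderiv_eq_zero_of_notMem_vars
      intro h
      obtain ⟨i, hi, h⟩ := Finset.mem_biUnion.1 (vars_prod _ h)
      have : a = i := by
        by_contra hne
        rw [Polynomial.aeval_eq_sum_range] at h
        obtain ⟨j, -, h⟩ := Finset.mem_biUnion.1 (vars_sum_subset _ _ h)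
        rw [smul_eq_C_mul] at h
        rcases Finset.mem_union.1 (vars_mul _ _ h) with h | h
        · simp at h
        · have := vars_pow _ _ h
          simp [vars_X, hne] at this
      exact Finset.ne_of_mem_erase hi this.symm

theorem aeval_derivative_X_pow (a k : ℕ) :
    Polynomial.aeval (Polynomial.derivative (R := ℂ)) (Polynomial.X ^ a : Polynomial ℂ)
      (Polynomial.X ^ k) = (k.descFactorial a : ℂ) • Polynomial.X ^ (k - a) := by
  rw [map_pow (Polynomial.aeval _), Polynomial.aeval_X, Module.End.pow_apply,
    Polynomial.iterate_derivative_X_pow_eq_smul]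

theorem aeval_derivative_C_sub_X (c : ℂ) (k : ℕ) :
    Polynomial.aeval (Polynomial.derivative (R := ℂ)) (Polynomial.C c - Polynomial.X : Polynomial ℂ)
      (Polynomial.X ^ k) =
      c • Polynomial.X ^ k - (k : ℂ) • Polynomial.X ^ (k - 1) := by
  simp [Polynomial.derivative_X_pow, Polynomial.smul_eq_C_mul]

theorem applyDiff_prod_X_pow [Fintype σ] (a k : σ → ℕ) :
    applyDiff σ (∏ i, X i ^ a i) (∏ i, X i ^ k i) =
      ∏ i, C ((k i).descFactorial (a i) : ℂ) * X i ^ (k i - a i) := by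
  have := applyDiff_prod_aeval_X (σ := σ) (fun i => Polynomial.X ^ a i)
    (fun i => Polynomial.X ^ k i)
  simp_rw [aeval_derivative_X_pow] at this
  simpa [smul_eq_C_mul] using this

theorem applyDiff_prod_C_sub_X [Fintype σ] (c : ℂ) (k : σ → ℕ) :
    applyDiff σ (∏ i, (C c - X i)) (∏ i, X i ^ k i) =
      ∏ i, (C c * X i ^ k i - C (k i : ℂ) * X i ^ (k i - 1)) := by
  have := applyDiff_prod_aeval_X (σ := σ) (fun _ => Polynomial.C c - Polynomial.X)
    (fun i => Polynomial.X ^ k i)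
  simp_rw [aeval_derivative_C_sub_X] at this
  simpa [smul_eq_C_mul, algebraMap_eq] using this

theorem constantCoeff_applyDiff_prod_X_pow [Fintype σ] [DecidableEq σ] (a k : σ → ℕ) :
    constantCoeff (applyDiff σ (∏ i, X i ^ a i) (∏ i, X i ^ k i)) =
      if a = k then ∏ i, ((a i).factorial : ℂ) else 0 := by
  rw [applyDiff_prod_X_pow, map_prod]
  split_ifs with h
  · subst h
    simp [Nat.descFactorial_self]
  · obtain ⟨i, hi⟩ := Function.ne_iff.1 h
    apply Finset.prod_eq_zero (Finset.mem_univ i)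
    rcases lt_or_gt_of_ne hi with hi | hi
    · simp [Nat.sub_ne_zero_of_lt hi]
    · simp [Nat.descFactorial_of_lt hi]

theorem eq_zero_of_constantCoeff_applyDiff [Fintype σ] {F : MvPolynomial σ ℂ}
    (h : ∀ a : σ → ℕ, constantCoeff (applyDiff σ (∏ i, X i ^ a i) F) = 0) : F = 0 := by
  classical
  ext m
  have key : constantCoeff (applyDiff σ (∏ i, X i ^ m i) F) =
      (∏ i, ((m i).factorial : ℂ)) * coeff m F := by
    clear h
    induction F using MvPolynomial.induction_on' with
    | monomial k a =>
      have hk : (monomial k a : MvPolynomial σ ℂ) = a • ∏ i, X i ^ k i := by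
        rw [monomial_eq, smul_eq_C_mul, Finsupp.prod_fintype _ _ (by simp)]
      rw [coeff_monomial, hk, map_smul, ← smul_eq_mul, constantCoeff_smul,
        constantCoeff_applyDiff_prod_X_pow]
      by_cases hkm : k = m
      · simp [hkm, mul_comm]
      · have : ¬ (m : σ → ℕ) = k := fun h => hkm (DFunLike.coe_injective h.symm)
        simp [hkm, this]
    | add p q hp hq => rw [map_add, map_add, hp, hq, coeff_add, mul_add]
  have := h m
  rw [key, mul_eq_zero] at this
  refine this.resolve_left (Finset.prod_ne_zero_iff.2 fun i _ => ?_)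
  exact_mod_cast (m i).factorial_ne_zero

end ApplyDiff
/-! ### Staircase monomials spanning coinvariant algebras -/

section Staircase

variable {R A κ : Type*} [CommRing R] [CommRing A] [Algebra R A] [LinearOrder κ] {d : ℕ}

/-- If `∏ (X - x s) = X ^ d`, then `x k` is a root of a monic polynomial of degree
`#{t | n t ≤ n k}` whose coefficients are polynomials in the `x t` with `k < t`. -/
theorem exists_monic_aeval_eq_zero [Nontrivial A] (x : Fin d → A)
    (hx : ∏ s, (Polynomial.X - Polynomial.C (x s)) = Polynomial.X ^ d)
    {n : Fin d → κ} (hn : Monotone n) (k : Fin d) :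
    ∃ q : Polynomial (Algebra.adjoin R (x '' {s | k < s})), q.Monic ∧
      q.natDegree = (Finset.univ.filter fun t => n t ≤ n k).card ∧
      Polynomial.aeval (x k) q = 0 := by
  classical
  set B := Algebra.adjoin R (x '' {s | k < s}) with hB
  let y : Fin d → B := fun t =>
    if h : k < t then ⟨x t, Algebra.subset_adjoin ⟨t, h, rfl⟩⟩ else 0
  let r : Polynomial B :=
    ∏ t ∈ Finset.univ.filter (fun t => ¬ n t ≤ n k), (Polynomial.X - Polynomial.C (y t))
  have hr : r.Monic := Polynomial.monic_prod_X_sub_C _ _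
  have hinj : Function.Injective (algebraMap B A) := Subtype.val_injective
  have hmap : (Polynomial.X ^ d /ₘ r).map (algebraMap B A) =
      ∏ t ∈ Finset.univ.filter (fun t => n t ≤ n k), (Polynomial.X - Polynomial.C (x t)) := by
    rw [Polynomial.map_divByMonic _ hr]
    have h1 : r.map (algebraMap B A) =
        ∏ t ∈ Finset.univ.filter (fun t => ¬ n t ≤ n k),
          (Polynomial.X - Polynomial.C (x t)) := by
      rw [Polynomial.map_prod]
      refine Finset.prod_congr rfl fun t ht => ?_
      have hkt : k < t := by
        by_contra hle
        exact (Finset.mem_filter.1 ht).2 (hn (not_lt.1 hle))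
      simp only [Polynomial.map_sub, Polynomial.map_X, Polynomial.map_C, y, dif_pos hkt]
      rfl
    rw [Polynomial.map_pow, Polynomial.map_X, ← hx,
      ← Finset.prod_filter_mul_prod_filter_not Finset.univ (fun t => n t ≤ n k), h1, mul_comm]
    exact Polynomial.mul_divByMonic_cancel_left _ (Polynomial.monic_prod_X_sub_C _ _)
  refine ⟨Polynomial.X ^ d /ₘ r, ?_, ?_, ?_⟩
  · apply Polynomial.monic_of_injective hinj
    rw [hmap]
    exact Polynomial.monic_prod_X_sub_C _ _
  · rw [← Polynomial.natDegree_map_eq_of_injective hinj, hmap,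
      Polynomial.natDegree_finsetProd_X_sub_C_eq_card]
  · rw [← Polynomial.eval_map_algebraMap, hmap, Polynomial.eval_prod]
    exact Finset.prod_eq_zero (i := k) (by simp) (by simp)

theorem mem_span_staircase_of_mem_adjoin_image (x : Fin d → A)
    (hx : ∏ s, (Polynomial.X - Polynomial.C (x s)) = Polynomial.X ^ d)
    {n : Fin d → κ} (hn : Monotone n) {k : ℕ} (hk : k ≤ d) :
    ∀ a ∈ Algebra.adjoin R (x '' {s | k ≤ (s : ℕ)}),
      a ∈ Submodule.span R {a | ∃ β : Fin d → ℕ,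
        (∀ s, β s < (Finset.univ.filter fun t => n t ≤ n s).card) ∧
        (∀ s : Fin d, (s : ℕ) < k → β s = 0) ∧ a = ∏ s, x s ^ β s} := by
  cases subsingleton_or_nontrivial A with
  | inl h =>
    intro a _
    rw [Subsingleton.elim a 0]
    exact zero_mem _
  | inr h =>
  have hpos : ∀ s, 0 < (Finset.univ.filter fun t => n t ≤ n s).card := fun s =>
    Finset.card_pos.2 ⟨s, by simp⟩
  induction hk using Nat.decreasingInduction with
  | self =>
    intro a ha
    have : {s : Fin d | d ≤ (s : ℕ)} = ∅ := by
      ext s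
      simp
    rw [this, Set.image_empty, Algebra.adjoin_empty, Algebra.mem_bot] at ha
    obtain ⟨c, rfl⟩ := ha
    rw [Algebra.algebraMap_eq_smul_one]
    exact Submodule.smul_mem _ _ (Submodule.subset_span ⟨0, hpos, by simp, by simp⟩)
  | of_succ k hkd ih =>
    intro a ha
    obtain ⟨q, hq, hdeg, hroot⟩ := exists_monic_aeval_eq_zero (R := R) x hx hn ⟨k, hkd⟩
    have hset : {s : Fin d | (⟨k, hkd⟩ : Fin d) < s} = {s : Fin d | k + 1 ≤ (s : ℕ)} := by
      ext s
      exact Fin.lt_def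
    obtain ⟨f, rfl⟩ : ∃ f : Polynomial (Algebra.adjoin R (x '' {s | (⟨k, hkd⟩ : Fin d) < s})),
        Polynomial.aeval (x ⟨k, hkd⟩) f = a := by
      have hle : Algebra.adjoin R (x '' {s | k ≤ (s : ℕ)}) ≤
          (Polynomial.aeval (R := Algebra.adjoin R (x '' {s | (⟨k, hkd⟩ : Fin d) < s}))
            (x ⟨k, hkd⟩)).range.restrictScalars R := by
        apply Algebra.adjoin_le
        rintro _ ⟨s, hs, rfl⟩
        rcases (show k ≤ (s : ℕ) from hs).eq_or_lt with hs | hs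
        · obtain rfl : s = ⟨k, hkd⟩ := Fin.ext hs.symm
          exact ⟨Polynomial.X, by simp⟩
        · refine ⟨Polynomial.C ⟨x s, Algebra.subset_adjoin ⟨s, Fin.lt_def.2 hs, rfl⟩⟩, ?_⟩
          simp [Polynomial.aeval_C]
      exact hle ha
    rw [← Polynomial.aeval_modByMonic_eq_self_of_root hroot, Polynomial.aeval_eq_sum_range]
    refine Submodule.sum_mem _ fun j hj => ?_
    have hjlt : j < (Finset.univ.filter fun t => n t ≤ n ⟨k, hkd⟩).card := by
      rw [← hdeg]
      have hq1 : q ≠ 1 := by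
        intro h1
        rw [h1, map_one] at hroot
        exact one_ne_zero hroot
      exact (Nat.lt_succ_iff.1 (Finset.mem_range.1 hj)).trans_lt
        (Polynomial.natDegree_modByMonic_lt f hq hq1)
    have hc := ih ((f %ₘ q).coeff j : A) (by
      rw [← hset]
      exact ((f %ₘ q).coeff j).2)
    rw [Algebra.smul_def]
    change ((f %ₘ q).coeff j : A) * _ ∈ _
    generalize ((f %ₘ q).coeff j : A) = c at hc
    induction hc using Submodule.span_induction with
    | zero => rw [zero_mul]; exact zero_mem _
    | add u v _ _ hu hv => rw [add_mul]; exact add_mem hu hv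
    | smul r u _ hu => rw [smul_mul_assoc]; exact Submodule.smul_mem _ _ hu
    | mem u hu =>
      obtain ⟨β, hβ, h0, rfl⟩ := hu
      refine Submodule.subset_span ⟨Function.update β ⟨k, hkd⟩ j, fun s => ?_, fun s hs => ?_, ?_⟩
      · by_cases hs : s = ⟨k, hkd⟩
        · subst hs
          simpa using hjlt
        · simpa [hs] using hβ s
      · have : s ≠ ⟨k, hkd⟩ := by
          rintro rfl
          exact lt_irrefl _ hs
        simpa [this] using h0 s (by omega)
      · rw [← Finset.mul_prod_erase _ _ (Finset.mem_univ ⟨k, hkd⟩),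
          ← Finset.mul_prod_erase _ _ (Finset.mem_univ ⟨k, hkd⟩), h0 _ (by simp), pow_zero,
          one_mul, Function.update_self, mul_comm]
        congr 1
        refine Finset.prod_congr rfl fun s hs => ?_
        rw [Function.update_of_ne (Finset.ne_of_mem_erase hs)]

theorem mem_span_staircase (x : Fin d → A)
    (hx : ∏ s, (Polynomial.X - Polynomial.C (x s)) = Polynomial.X ^ d)
    {n : Fin d → κ} (hn : Monotone n) {a : A} (ha : a ∈ Algebra.adjoin R (Set.range x)) :
    a ∈ Submodule.span R {a | ∃ β : Fin d → ℕ,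
        (∀ s, β s < (Finset.univ.filter fun t => n t ≤ n s).card) ∧ a = ∏ s, x s ^ β s} := by
  have := mem_span_staircase_of_mem_adjoin_image (R := R) x hx hn (Nat.zero_le d) a
    (by simpa using ha)
  refine Submodule.span_mono ?_ this
  rintro _ ⟨β, hβ, -, rfl⟩
  exact ⟨β, hβ, rfl⟩

end Staircase
/-! ### Harmonic polynomials for the symmetric group -/

section Harmonic

variable {d : ℕ}

/-- Polynomials `F` with `∏ (c - ∂_s) F = c ^ d F` for every scalar `c`; equivalently, those killed
by all symmetric constant coefficient differential operators without constant term. -/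
def IsHarmonic (F : MvPolynomial (Fin d) ℂ) : Prop :=
  ∀ c : ℂ, applyDiff (Fin d) (∏ s, (C c - X s)) F = c ^ d • F

variable (d) in
/-- The ideal generated by the nonleading coefficients of `∏ (T - X s)`, i.e. by the elementary
symmetric polynomials of positive degree. -/
noncomputable def coinvariantIdeal : Ideal (MvPolynomial (Fin d) ℂ) :=
  Ideal.span (Set.range fun j : Fin d =>
    (∏ s : Fin d, (Polynomial.X - Polynomial.C (X s : MvPolynomial (Fin d) ℂ))).coeff j)

theorem IsHarmonic.applyDiff {F : MvPolynomial (Fin d) ℂ} (hF : IsHarmonic F)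
    (g : MvPolynomial (Fin d) ℂ) : IsHarmonic (applyDiff (Fin d) g F) := by
  intro c
  rw [← Module.End.mul_apply, ← map_mul, mul_comm, map_mul, Module.End.mul_apply, hF c, map_smul]

theorem IsHarmonic.sub {F G : MvPolynomial (Fin d) ℂ} (hF : IsHarmonic F) (hG : IsHarmonic G) :
    IsHarmonic (F - G) := by
  intro c
  rw [map_sub, hF c, hG c, smul_sub]

theorem eq_zero_of_forall_sum_pow_smul_eq_zero (v : Fin d → ℂ)
    (h : ∀ c : ℂ, ∑ j : Fin d, c ^ (j : ℕ) * v j = 0) (j : Fin d) : v j = 0 := by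
  have hp : ∑ j : Fin d, Polynomial.monomial (j : ℕ) (v j) = 0 := by
    refine Polynomial.funext fun c => ?_
    rw [Polynomial.eval_finsetSum, Polynomial.eval_zero, ← h c]
    exact Finset.sum_congr rfl fun j _ => by rw [Polynomial.eval_monomial, mul_comm]
  have := congrArg (fun p => Polynomial.coeff p j) hp
  simpa [Polynomial.finsetSum_coeff, Polynomial.coeff_monomial, Fin.val_inj] using this

theorem IsHarmonic.applyDiff_eq_zero {F : MvPolynomial (Fin d) ℂ} (hF : IsHarmonic F)
    {g : MvPolynomial (Fin d) ℂ} (hg : g ∈ coinvariantIdeal d) :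
    _root_.applyDiff (Fin d) g F = 0 := by
  induction hg using Submodule.span_induction with
  | zero => simp
  | add u v _ _ hu hv => rw [map_add, LinearMap.add_apply, hu, hv, add_zero]
  | smul a u _ hu => rw [smul_eq_mul, map_mul, Module.End.mul_apply, hu, map_zero]
  | mem u hu =>
    obtain ⟨j, rfl⟩ := hu
    set p := ∏ s : Fin d, (Polynomial.X - Polynomial.C (X s : MvPolynomial (Fin d) ℂ)) with hp
    have hdeg : p.natDegree = d := by
      rw [hp, Polynomial.natDegree_finsetProd_X_sub_C_eq_card, Finset.card_fin]
    have hlead : p.coeff d = 1 := by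
      have := Polynomial.monic_prod_X_sub_C (fun s => (X s : MvPolynomial (Fin d) ℂ)) Finset.univ
      rw [← hp, Polynomial.Monic, Polynomial.leadingCoeff, hdeg] at this
      exact this
    have heval : ∀ c : ℂ, ∏ s : Fin d, (C c - X s) =
        ∑ j : Fin d, c ^ (j : ℕ) • p.coeff j + c ^ d • 1 := by
      intro c
      have h1 : p.eval (C c) = ∏ s : Fin d, (C c - X s) := by
        simp [hp, Polynomial.eval_prod]
      rw [← h1, Polynomial.eval_eq_sum_range, hdeg, Finset.sum_range_succ, hlead,
        Finset.sum_range]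
      simp [smul_eq_C_mul, mul_comm]
    ext m
    rw [coeff_zero]
    refine eq_zero_of_forall_sum_pow_smul_eq_zero
      (fun j => coeff m (_root_.applyDiff (Fin d) (p.coeff j) F)) (fun c => ?_) j
    have := hF c
    rw [heval, map_add, LinearMap.add_apply, map_smul, map_one, LinearMap.smul_apply,
      Module.End.one_apply, add_eq_right, map_sum, LinearMap.sum_apply] at this
    have := congrArg (coeff m) this
    simpa [coeff_sum] using this

theorem exists_staircase_sub_mem_coinvariantIdeal {κ : Type*} [LinearOrder κ] {n : Fin d → κ}
    (hn : Monotone n) (g : MvPolynomial (Fin d) ℂ) :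
    ∃ g' ∈ Submodule.span ℂ {a | ∃ β : Fin d → ℕ,
        (∀ s, β s < (Finset.univ.filter fun t => n t ≤ n s).card) ∧
        a = ∏ s, (X s : MvPolynomial (Fin d) ℂ) ^ β s},
      g - g' ∈ coinvariantIdeal d := by
  let π := Ideal.Quotient.mkₐ ℂ (coinvariantIdeal d)
  have hx : ∏ s, (Polynomial.X - Polynomial.C (π (X s))) = Polynomial.X ^ d := by
    set p := ∏ s : Fin d, (Polynomial.X - Polynomial.C (X s : MvPolynomial (Fin d) ℂ)) with hp
    have hdeg : p.natDegree = d := by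
      rw [hp, Polynomial.natDegree_finsetProd_X_sub_C_eq_card, Finset.card_fin]
    have hmon : p.Monic := Polynomial.monic_prod_X_sub_C _ _
    have : p.map (π : MvPolynomial (Fin d) ℂ →+* MvPolynomial (Fin d) ℂ ⧸ coinvariantIdeal d) =
        Polynomial.X ^ d := by
      ext j
      rw [Polynomial.coeff_map, Polynomial.coeff_X_pow]
      rcases lt_trichotomy j d with hj | rfl | hj
      · rw [if_neg hj.ne]
        exact Ideal.Quotient.eq_zero_iff_mem.2 (Ideal.subset_span ⟨⟨j, hj⟩, rfl⟩)
      · have : p.coeff j = 1 := by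
          rw [Polynomial.Monic, Polynomial.leadingCoeff, hdeg] at hmon
          exact hmon
        rw [this, if_pos rfl, map_one]
      · rw [Polynomial.coeff_eq_zero_of_natDegree_lt (by rwa [hdeg]), if_neg hj.ne', map_zero]
    rw [← this, hp, Polynomial.map_prod]
    simp
  have hmem : π g ∈ Algebra.adjoin ℂ (Set.range fun s => π (X s)) := by
    have : (Set.range fun s => π (X s)) = π '' Set.range X := by
      rw [← Set.range_comp]
      rfl
    rw [this, ← AlgHom.map_adjoin, adjoin_range_X]
    exact ⟨g, trivial, rfl⟩
  have h := mem_span_staircase (R := ℂ) _ hx hn hmem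
  have himg : {a | ∃ β : Fin d → ℕ, (∀ s, β s < (Finset.univ.filter fun t => n t ≤ n s).card) ∧
      a = ∏ s, π (X s) ^ β s} = π.toLinearMap '' {a | ∃ β : Fin d → ℕ,
        (∀ s, β s < (Finset.univ.filter fun t => n t ≤ n s).card) ∧
        a = ∏ s, (X s : MvPolynomial (Fin d) ℂ) ^ β s} := by
    ext a
    constructor
    · rintro ⟨β, hβ, rfl⟩
      exact ⟨_, ⟨β, hβ, rfl⟩, by simp⟩
    · rintro ⟨_, ⟨β, hβ, rfl⟩, rfl⟩
      exact ⟨β, hβ, by simp⟩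
  rw [himg, Submodule.span_image] at h
  obtain ⟨g', hg', h⟩ := h
  exact ⟨g', hg', Ideal.Quotient.eq.1 h.symm⟩

theorem IsHarmonic.applyDiff_mem_span {κ : Type*} [LinearOrder κ] {n : Fin d → κ}
    (hn : Monotone n) {F : MvPolynomial (Fin d) ℂ} (hF : IsHarmonic F)
    (g : MvPolynomial (Fin d) ℂ) :
    _root_.applyDiff (Fin d) g F ∈ Submodule.span ℂ {G | ∃ β : Fin d → ℕ,
        (∀ s, β s < (Finset.univ.filter fun t => n t ≤ n s).card) ∧
        G = _root_.applyDiff (Fin d) (∏ s, X s ^ β s) F} := by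
  obtain ⟨g', hg', h⟩ := exists_staircase_sub_mem_coinvariantIdeal hn g
  have h0 := hF.applyDiff_eq_zero h
  rw [map_sub, LinearMap.sub_apply, sub_eq_zero] at h0
  rw [h0]
  clear h h0
  induction hg' using Submodule.span_induction with
  | zero => simp
  | add u v _ _ hu hv => rw [map_add]; exact add_mem hu hv
  | smul c u _ hu => rw [map_smul]; exact Submodule.smul_mem _ _ hu
  | mem u hu =>
    obtain ⟨β, hβ, rfl⟩ := hu
    exact Submodule.subset_span ⟨β, hβ, rfl⟩

variable (d) in
/-- The Vandermonde determinant `det (X_s ^ r)`, with rows indexed by `r`. -/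
noncomputable def vandermondeDet : MvPolynomial (Fin d) ℂ :=
  Matrix.det (Matrix.of fun r s : Fin d => X s ^ (r : ℕ))

theorem vandermondeDet_eq_sum : vandermondeDet d =
    ∑ w : Equiv.Perm (Fin d), Equiv.Perm.sign w • ∏ s, X s ^ (w s : ℕ) := by
  rw [vandermondeDet, Matrix.det_apply]
  rfl

theorem isHarmonic_vandermondeDet : IsHarmonic (vandermondeDet d) := by
  intro c
  have h1 : applyDiff (Fin d) (∏ s, (C c - X s)) (vandermondeDet d) =
      Matrix.det (Matrix.of fun r s : Fin d =>
        (C c * X s ^ (r : ℕ) - C ((r : ℕ) : ℂ) * X s ^ ((r : ℕ) - 1) :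
          MvPolynomial (Fin d) ℂ)) := by
    rw [vandermondeDet_eq_sum, map_sum, Matrix.det_apply]
    refine Finset.sum_congr rfl fun w _ => ?_
    rw [Units.smul_def, Units.smul_def, map_zsmul, applyDiff_prod_C_sub_X]
    rfl
  let L : Matrix (Fin d) (Fin d) (MvPolynomial (Fin d) ℂ) := Matrix.of fun r k =>
    if k = r then C c else if (k : ℕ) + 1 = r then - C ((r : ℕ) : ℂ) else 0
  have h2 : (Matrix.of fun r s : Fin d =>
        (C c * X s ^ (r : ℕ) - C ((r : ℕ) : ℂ) * X s ^ ((r : ℕ) - 1) :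
          MvPolynomial (Fin d) ℂ)) = L * Matrix.of fun r s : Fin d => X s ^ (r : ℕ) := by
    ext1 r s
    rw [Matrix.mul_apply]
    simp only [Matrix.of_apply, L]
    rw [← Finset.add_sum_erase _ _ (Finset.mem_univ r), if_pos rfl, sub_eq_add_neg]
    congr 1
    rcases Nat.eq_zero_or_pos (r : ℕ) with hr | hr
    · rw [Finset.sum_eq_zero]
      · simp [hr]
      · intro k hk
        rw [if_neg (Finset.ne_of_mem_erase hk), if_neg (by omega), zero_mul]
    · have hlt : (r : ℕ) - 1 < d := by omega
      rw [Finset.sum_eq_single ⟨(r : ℕ) - 1, hlt⟩]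
      · rw [if_neg (fun h => by have := congrArg Fin.val h; simp at this; omega),
          if_pos (by simp; omega), neg_mul]
      · intro k hk hne
        rw [if_neg (Finset.ne_of_mem_erase hk), if_neg, zero_mul]
        intro h
        exact hne (Fin.ext (by simp; omega))
      · intro h
        exact absurd (Finset.mem_erase.2 ⟨fun h => by
          have := congrArg Fin.val h; simp at this; omega, Finset.mem_univ _⟩) h
  have h3 : L.det = C c ^ d := by
    rw [Matrix.det_of_isLowerTriangular L]
    · simp [L]
    · intro i j hij
      have hij : i < j := hij
      simp only [L, Matrix.of_apply]
      rw [if_neg hij.ne', if_neg (by have := Fin.lt_def.1 hij; omega)]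
  rw [h1, h2, Matrix.det_mul, h3, ← map_pow, smul_eq_C_mul, vandermondeDet]

theorem constantCoeff_applyDiff_vandermondeDet (γ : Fin d → ℕ) :
    constantCoeff (applyDiff (Fin d) (∏ s, X s ^ γ s) (vandermondeDet d)) =
      ∑ w : Equiv.Perm (Fin d), Equiv.Perm.sign w •
        if γ = (fun s => (w s : ℕ)) then ∏ s, ((γ s).factorial : ℂ) else 0 := by
  rw [vandermondeDet_eq_sum, map_sum, map_sum]
  refine Finset.sum_congr rfl fun w _ => ?_
  rw [Units.smul_def, Units.smul_def, map_zsmul, map_zsmul, constantCoeff_applyDiff_prod_X_pow]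

/-- The strict rearrangement inequality for `0, 1, …, d - 1`. -/
theorem perm_eq_one_of_sum_mul_le (w : Equiv.Perm (Fin d))
    (h : ∑ s : Fin d, (s : ℕ) * s ≤ ∑ s : Fin d, (s : ℕ) * w s) : w = 1 := by
  have h1 : ∑ s : Fin d, ((s : ℤ) - (w s : ℕ)) ^ 2 ≤ 0 := by
    have h2 : ∑ s : Fin d, ((w s : ℕ) : ℤ) * (w s : ℕ) = ∑ s : Fin d, (s : ℤ) * s :=
      Equiv.sum_comp w fun s : Fin d => (s : ℤ) * s
    have h3 : ∑ s : Fin d, (s : ℤ) * s ≤ ∑ s : Fin d, (s : ℤ) * (w s : ℕ) := by exact_mod_cast h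
    calc ∑ s : Fin d, ((s : ℤ) - (w s : ℕ)) ^ 2
        = ∑ s : Fin d, ((s : ℤ) * s + ((w s : ℕ) : ℤ) * (w s : ℕ) - 2 * (s * (w s : ℕ))) :=
          Finset.sum_congr rfl fun s _ => by ring
      _ ≤ 0 := by
          rw [Finset.sum_sub_distrib, Finset.sum_add_distrib, ← Finset.mul_sum, h2]
          linarith
  have h4 := (Finset.sum_eq_zero_iff_of_nonneg fun s _ => sq_nonneg _).1
    (le_antisymm h1 (Finset.sum_nonneg fun s _ => sq_nonneg _))
  ext s
  have := pow_eq_zero_iff (two_ne_zero) |>.1 (h4 s (Finset.mem_univ s))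
  rw [Equiv.Perm.one_apply]
  omega

theorem constantCoeff_applyDiff_vandermondeDet_self :
    constantCoeff (applyDiff (Fin d) (∏ s : Fin d, X s ^ (s : ℕ)) (vandermondeDet d)) ≠ 0 := by
  rw [constantCoeff_applyDiff_vandermondeDet, Finset.sum_eq_single 1]
  · simp [Finset.prod_ne_zero_iff, Nat.factorial_ne_zero]
  · intro w _ hw
    rw [if_neg, smul_zero]
    intro h
    apply hw
    ext s
    exact (congrFun h s).symm
  · simp

theorem linearIndependent_constantCoeff_applyDiff_vandermondeDet :
    LinearIndependent ℂ fun (β : (s : Fin d) → Fin (s + 1)) (α : (s : Fin d) → Fin (s + 1)) =>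
      constantCoeff (applyDiff (Fin d) (∏ s, X s ^ (α s : ℕ))
        (applyDiff (Fin d) (∏ s, X s ^ (β s : ℕ)) (vandermondeDet d))) := by
  rw [Fintype.linearIndependent_iff]
  intro c hc
  suffices h : ∀ k : ℕ, ∀ α, ∑ s : Fin d, (s : ℕ) * (α s : ℕ) = k → c α = 0 from
    fun α => h _ α rfl
  intro k
  induction k using Nat.strong_induction_on with
  | _ k ih =>
    rintro α rfl
    have h := congrFun hc fun s => ⟨s - α s, by omega⟩
    simp only [Finset.sum_apply, Pi.smul_apply, Pi.zero_apply, smul_eq_mul] at h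
    simp_rw [← Module.End.mul_apply, ← map_mul, ← Finset.prod_mul_distrib, ← pow_add] at h
    rw [Finset.sum_eq_single α] at h
    · refine (mul_eq_zero.1 h).resolve_right ?_
      have hα : ∀ s : Fin d, (s : ℕ) - α s + α s = s := fun s =>
        Nat.sub_add_cancel (Nat.lt_succ_iff.1 (α s).2)
      simp_rw [hα]
      exact constantCoeff_applyDiff_vandermondeDet_self
    · intro β _ hβ
      by_cases hlt : ∑ s : Fin d, (s : ℕ) * (β s : ℕ) < ∑ s : Fin d, (s : ℕ) * (α s : ℕ)
      · rw [ih _ hlt β rfl, zero_mul]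
      rw [constantCoeff_applyDiff_vandermondeDet, Finset.sum_eq_zero, mul_zero]
      intro w _
      rw [if_neg, smul_zero]
      intro hw
      have hw' : ∀ s : Fin d, (s : ℕ) + β s = w s + α s := fun s => by
        have := congrFun hw s
        have := (α s).2
        omega
      have hsum : ∑ s : Fin d, (s : ℕ) * s + ∑ s : Fin d, (s : ℕ) * (β s : ℕ) =
          ∑ s : Fin d, (s : ℕ) * w s + ∑ s : Fin d, (s : ℕ) * (α s : ℕ) := by
        simp_rw [← Finset.sum_add_distrib, ← mul_add, hw']
      obtain rfl := perm_eq_one_of_sum_mul_le w (by omega)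
      apply hβ
      funext s
      have := hw' s
      rw [Equiv.Perm.one_apply] at this
      exact Fin.ext (by omega)
    · simp

/-- Every harmonic polynomial is a derivative of the Vandermonde determinant. -/
theorem IsHarmonic.exists_eq_applyDiff_vandermondeDet {F : MvPolynomial (Fin d) ℂ}
    (hF : IsHarmonic F) : ∃ g, F = _root_.applyDiff (Fin d) g (vandermondeDet d) := by
  let L : MvPolynomial (Fin d) ℂ →ₗ[ℂ] ((s : Fin d) → Fin (s + 1)) → ℂ :=
    LinearMap.pi fun α => lcoeff ℂ 0 ∘ₗ _root_.applyDiff (Fin d) (∏ s, X s ^ (α s : ℕ))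
  have hL : ∀ G α, L G α =
      constantCoeff (_root_.applyDiff (Fin d) (∏ s, X s ^ (α s : ℕ)) G) := fun _ _ => rfl
  have hinj : ∀ G, IsHarmonic G → L G = 0 → G = 0 := by
    intro G hG hLG
    refine eq_zero_of_constantCoeff_applyDiff fun a => ?_
    have h := hG.applyDiff_mem_span monotone_id (∏ s, X s ^ a s)
    generalize _root_.applyDiff (Fin d) (∏ s, X s ^ a s) G = H at h
    induction h using Submodule.span_induction with
    | zero => simp
    | add u v _ _ hu hv => rw [map_add, hu, hv, add_zero]
    | smul c u _ hu => rw [constantCoeff_smul, hu, smul_zero]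
    | mem u hu =>
      obtain ⟨β, hβ, rfl⟩ := hu
      have hβ' : ∀ s : Fin d, β s < s + 1 := fun s => by
        simpa [Finset.filter_ge_eq_Iic] using hβ s
      exact congrFun hLG fun s => ⟨β s, hβ' s⟩
  have htop := linearIndependent_constantCoeff_applyDiff_vandermondeDet (d := d)
    |>.span_eq_top_of_card_eq_finrank' (by simp)
  have hmem : L F ∈ (⊤ : Submodule ℂ (((s : Fin d) → Fin (s + 1)) → ℂ)) := trivial
  rw [← htop, Submodule.mem_span_range_iff_exists_fun] at hmem
  obtain ⟨c, hc⟩ := hmem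
  refine ⟨∑ β, c β • ∏ s, X s ^ (β s : ℕ), ?_⟩
  rw [← sub_eq_zero]
  refine hinj _ (hF.sub (isHarmonic_vandermondeDet.applyDiff _)) ?_
  rw [map_sub, sub_eq_zero, ← hc, map_sum, LinearMap.sum_apply, map_sum]
  refine Finset.sum_congr rfl fun β _ => ?_
  rw [map_smul, LinearMap.smul_apply, map_smul]
  rfl

end Harmonic
/-! ### Polarization of polynomials in jet variables -/

section Polarization

variable {ι : Type*} {d : ℕ}

/-- The linear map sending `∏ X_s ^ β_s` to `∏ X_{n_s}^{(β_s)}`. -/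
noncomputable def restitution (n : Fin d → ι) :
    MvPolynomial (Fin d) ℂ →ₗ[ℂ] MvPolynomial (ι × ℕ) ℂ :=
  (basisMonomials (Fin d) ℂ).constr ℂ fun β => ∏ s, X (n s, β s)

theorem restitution_prod_C_mul_X_pow (n : Fin d → ι) (c : Fin d → ℂ) (k : Fin d → ℕ) :
    restitution n (∏ s, C (c s) * X s ^ k s) = ∏ s, C (c s) * X (n s, k s) := by
  have h : ∏ s, (X s : MvPolynomial (Fin d) ℂ) ^ k s =
      basisMonomials (Fin d) ℂ (Finsupp.equivFunOnFinite.symm k) := by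
    rw [coe_basisMonomials]
    simp only
    rw [monomial_eq, Finsupp.prod_fintype _ _ (by simp)]
    simp
  rw [Finset.prod_mul_distrib, Finset.prod_mul_distrib, ← map_prod, ← smul_eq_C_mul, map_smul, h,
    restitution, Module.Basis.constr_basis, ← map_prod, smul_eq_C_mul]
  rfl

theorem restitution_prod_X_pow (n : Fin d → ι) (k : Fin d → ℕ) :
    restitution n (∏ s, X s ^ k s) = ∏ s, X (n s, k s) := by
  simpa using restitution_prod_C_mul_X_pow n 1 k

theorem coeff_one_prod_sum {R : Type*} [CommRing R] (a : Fin d → Fin d → R) :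
    coeff (Finsupp.equivFunOnFinite.symm 1) (∏ t, ∑ s, C (a t s) * X s : MvPolynomial (Fin d) R) =
      ∑ w : Equiv.Perm (Fin d), ∏ s, a (w s) s := by
  classical
  have h1 : ∀ f : Fin d → Fin d,
      coeff (Finsupp.equivFunOnFinite.symm 1)
        (∏ t, (C (a t (f t)) * X (f t) : MvPolynomial (Fin d) R)) =
      if Function.Bijective f then ∏ t, a t (f t) else 0 := by
    intro f
    have hX : ∏ t, (X (f t) : MvPolynomial (Fin d) R) =
        monomial (∑ t, Finsupp.single (f t) 1) 1 := by
      rw [monomial_sum_one]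
      rfl
    rw [Finset.prod_mul_distrib, ← map_prod, coeff_C_mul, hX, coeff_monomial, mul_ite, mul_one,
      mul_zero]
    refine if_congr ⟨fun h => ?_, fun h => ?_⟩ rfl rfl
    · rw [← Finite.surjective_iff_bijective]
      intro s
      by_contra! hs
      have := DFunLike.congr_fun h s
      simp [Finsupp.finsetSum_apply, hs] at this
    · ext s
      rw [Finsupp.finsetSum_apply]
      obtain ⟨t, rfl⟩ := h.2 s
      simp [Finsupp.single_apply, h.1.eq_iff]
  rw [Finset.prod_univ_sum, coeff_sum, Fintype.piFinset_univ]
  simp_rw [h1]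
  rw [← Finset.sum_filter, ← Equiv.sum_comp (Equiv.inv (Equiv.Perm (Fin d)))]
  symm
  refine Finset.sum_bij (fun w _ => (w : Fin d → Fin d)) ?_ ?_ ?_ ?_
  · intro w _
    exact Finset.mem_filter.2 ⟨Finset.mem_univ _, w.bijective⟩
  · intro w _ w' _ h
    exact DFunLike.coe_injective h
  · intro f hf
    exact ⟨Equiv.ofBijective f (Finset.mem_filter.1 hf).2, Finset.mem_univ _, rfl⟩
  · intro w _
    rw [← Equiv.prod_comp w]
    simp

variable [DecidableEq ι]

/-- The algebra homomorphism evaluating a polynomial in jet variables at the generic sum of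
exponentials `∑_s Z_s e^{X_s t}`, where the `s`-th summand is placed in the `n_s`-th coordinate. -/
noncomputable def evalExp (n : Fin d → ι) :
    MvPolynomial (ι × ℕ) ℂ →ₐ[ℂ] MvPolynomial (Fin d) (MvPolynomial (Fin d) ℂ) :=
  aeval fun p => ∑ s, C (if n s = p.1 then X s ^ p.2 else 0) * X s

/-- The multilinear part of `evalExp`. -/
noncomputable def polarization (n : Fin d → ι) :
    MvPolynomial (ι × ℕ) ℂ →ₗ[ℂ] MvPolynomial (Fin d) ℂ :=
  (lcoeff (MvPolynomial (Fin d) ℂ) (Finsupp.equivFunOnFinite.symm 1)).restrictScalars ℂ ∘ₗ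
    (evalExp n).toLinearMap

theorem polarization_prod (n : Fin d → ι) (ℓ : Fin d → MvPolynomial (ι × ℕ) ℂ)
    (a : Fin d → Fin d → MvPolynomial (Fin d) ℂ)
    (h : ∀ t, evalExp n (ℓ t) = ∑ s, C (a t s) * X s) :
    polarization n (∏ t, ℓ t) = ∑ w : Equiv.Perm (Fin d), ∏ s, a (w s) s := by
  rw [← coeff_one_prod_sum]
  simp_rw [← h, ← map_prod]
  rfl

theorem polarization_prod_X (n : Fin d → ι) (v : Fin d → ι × ℕ) :
    polarization n (∏ t, X (v t)) = ∑ w : Equiv.Perm (Fin d),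
      ∏ s, if n s = (v (w s)).1 then (X s : MvPolynomial (Fin d) ℂ) ^ (v (w s)).2 else 0 :=
  polarization_prod n _ (fun t s => if n s = (v t).1 then X s ^ (v t).2 else 0)
    fun t => by simp [evalExp]

theorem factorial_smul_eq_sum_restitution_polarization [Fintype ι] {P : MvPolynomial (ι × ℕ) ℂ}
    (hP : P ∈ Submodule.span ℂ (Set.range fun v : Fin d → ι × ℕ => ∏ t, X (v t))) :
    (d.factorial : ℂ) • P = ∑ n : Fin d → ι, restitution n (polarization n P) := by
  induction hP using Submodule.span_induction with
  | zero => simp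
  | add u v _ _ hu hv => simp only [smul_add, hu, hv, map_add, Finset.sum_add_distrib]
  | smul c u _ hu => rw [smul_comm, hu, Finset.smul_sum]; simp only [map_smul]
  | mem u hu =>
    obtain ⟨v, rfl⟩ := hu
    simp_rw [polarization_prod_X, map_sum]
    rw [Finset.sum_comm]
    have h : ∀ w : Equiv.Perm (Fin d), ∑ n : Fin d → ι, restitution n (∏ s,
        if n s = (v (w s)).1 then (X s : MvPolynomial (Fin d) ℂ) ^ (v (w s)).2 else 0) =
        ∏ t, X (v t) := by
      intro w
      rw [Finset.sum_eq_single fun s => (v (w s)).1]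
      · simp only [if_true, restitution_prod_X_pow, Prod.mk.eta]
        exact Equiv.prod_comp w fun t => (X (v t) : MvPolynomial (ι × ℕ) ℂ)
      · intro n _ hn
        obtain ⟨s, hs⟩ := Function.ne_iff.1 hn
        rw [Finset.prod_eq_zero (Finset.mem_univ s) (if_neg hs), map_zero]
      · simp
    simp_rw [h]
    simp [Fintype.card_perm, Nat.cast_smul_eq_nsmul]

/-- The substitution `X_i^{(k)} ↦ a X_i^{(k)} + b k X_i^{(k-1)}`, i.e. the effect at `t = 0` of
multiplying all functions by `a + b t`. -/
noncomputable def twist (a b : ℂ) : MvPolynomial (ι × ℕ) ℂ →ₐ[ℂ] MvPolynomial (ι × ℕ) ℂ :=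
  aeval fun p => C a * X p + C (b * p.2) * X (p.1, p.2 - 1)

theorem polarization_twist (n : Fin d → ι) (c : ℂ) {P : MvPolynomial (ι × ℕ) ℂ}
    (hP : P ∈ Submodule.span ℂ (Set.range fun v : Fin d → ι × ℕ => ∏ t, X (v t))) :
    polarization n (twist c (-1) P) =
      applyDiff (Fin d) (∏ s, (C c - X s)) (polarization n P) := by
  induction hP using Submodule.span_induction with
  | zero => simp
  | add u v _ _ hu hv => simp only [hu, hv, map_add]
  | smul c u _ hu => simp only [hu, map_smul]
  | mem u hu =>
    obtain ⟨v, rfl⟩ := hu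
    rw [polarization_prod_X, map_prod, polarization_prod n _ (fun t s => if n s = (v t).1 then
      C c * X s ^ (v t).2 - C ((v t).2 : ℂ) * X s ^ ((v t).2 - 1) else 0), map_sum]
    · refine Finset.sum_congr rfl fun w _ => ?_
      by_cases h : ∀ s, n s = (v (w s)).1
      · simp only [h, if_true]
        rw [applyDiff_prod_C_sub_X]
      · push Not at h
        obtain ⟨s, hs⟩ := h
        have h0 : ∏ s, (if n s = (v (w s)).1 then
            (X s : MvPolynomial (Fin d) ℂ) ^ (v (w s)).2 else 0) = 0 :=
          Finset.prod_eq_zero (Finset.mem_univ s) (if_neg hs)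
        rw [h0, map_zero]
        exact Finset.prod_eq_zero (Finset.mem_univ s) (if_neg hs)
    · intro t
      simp only [twist, aeval_X, map_add, map_mul, evalExp, algHom_C, Finset.mul_sum,
        ← Finset.sum_add_distrib]
      refine Finset.sum_congr rfl fun s _ => ?_
      by_cases hs : n s = (v t).1
      · simp [hs, algebraMap_eq]
        ring
      · simp [hs]

end Polarization

section Homogeneous

variable {τ : Type*} {d : ℕ}

theorem coeff_aeval_C_mul_X (a : ℂ) (P : MvPolynomial τ ℂ) (m : τ →₀ ℕ) :
    coeff m (aeval (fun p => C a * X p : τ → MvPolynomial τ ℂ) P) = a ^ m.degree * coeff m P := by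
  classical
  induction P using MvPolynomial.induction_on' with
  | monomial k c =>
    have : aeval (fun p => C a * X p : τ → MvPolynomial τ ℂ) (monomial k c) =
        monomial k (a ^ k.degree * c) := by
      rw [aeval_monomial, Finsupp.prod]
      simp_rw [mul_pow]
      rw [Finset.prod_mul_distrib, Finset.prod_pow_eq_pow_sum, monomial_eq, Finsupp.prod,
        algebraMap_eq]
      rw [Finsupp.degree_apply, map_mul, map_pow]
      ring
    rw [this, coeff_monomial, coeff_monomial]
    split_ifs with h
    · rw [h]
    · rw [mul_zero]
  | add p q hp hq => rw [map_add, coeff_add, hp, hq, coeff_add, mul_add]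

theorem mem_span_prod_X {P : MvPolynomial τ ℂ} (hP : ∀ m ∈ P.support, m.degree = d) :
    P ∈ Submodule.span ℂ (Set.range fun v : Fin d → τ =>
      ∏ t, (X (v t) : MvPolynomial τ ℂ)) := by
  rw [P.as_sum]
  refine Submodule.sum_mem _ fun m hm => ?_
  obtain ⟨v, hv⟩ : ∃ v : Fin d → τ, ∑ t, Finsupp.single (v t) 1 = m := by
    have hd := hP m hm
    clear hm hP
    induction d generalizing m with
    | zero => exact ⟨Fin.elim0, by simpa using ((Finsupp.degree_eq_zero_iff m).1 hd).symm⟩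
    | succ d ih =>
      obtain ⟨p, hp⟩ : ∃ p, m p ≠ 0 := by
        by_contra! h
        obtain rfl : m = 0 := Finsupp.ext h
        simp at hd
      have hle : Finsupp.single p 1 ≤ m := by
        rw [Finsupp.single_le_iff]
        omega
      obtain ⟨m', rfl⟩ := exists_add_of_le hle
      obtain ⟨v, hv⟩ := ih m' (by simpa [add_comm 1] using hd)
      exact ⟨Fin.cons p v, by simp [Fin.sum_univ_succ, hv]⟩
  have : monomial m (coeff m P) = coeff m P • ∏ t, (X (v t) : MvPolynomial τ ℂ) := by
    have hX : ∏ t, (X (v t) : MvPolynomial τ ℂ) = monomial (∑ t, Finsupp.single (v t) 1) 1 := by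
      rw [monomial_sum_one]
      rfl
    rw [hX, hv, smul_monomial, smul_eq_mul, mul_one]
  rw [this]
  exact Submodule.smul_mem _ _ (Submodule.subset_span ⟨v, rfl⟩)

end Homogeneous
/-! ### Wronskian determinants -/

section Wronskian

variable {d : ℕ}

theorem choose_mul_descFactorial_add {r α j : ℕ} (h : α ≤ r) :
    r.choose (α + j) * (α + j).descFactorial α = r.descFactorial α * (r - α).choose j := by
  rw [Nat.descFactorial_eq_factorial_mul_choose, Nat.descFactorial_eq_factorial_mul_choose,
    mul_left_comm]
  rcases le_or_gt (α + j) r with hj | hj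
  · rw [Nat.choose_mul (Nat.le_add_right α j), Nat.add_sub_cancel_left, mul_assoc]
  · rw [Nat.choose_eq_zero_of_lt hj, Nat.choose_eq_zero_of_lt (by omega : r - α < j)]
    simp

/-- The Wronskian-type determinant of `t ^ α_s X_{n_s}`, `s = 1, …, d`, evaluated at `t = 0`. -/
noncomputable def wronskDet {ι : Type*} (n : Fin d → ι) (α : Fin d → ℕ) :
    MvPolynomial (ι × ℕ) ℂ :=
  Matrix.det (Matrix.of fun r s : Fin d =>
    C (((r : ℕ).descFactorial (α s) : ℕ) : ℂ) * X (n s, (r : ℕ) - α s))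

theorem restitution_applyDiff_vandermondeDet {ι : Type*} (n : Fin d → ι) (α : Fin d → ℕ) :
    restitution n (applyDiff (Fin d) (∏ s, X s ^ α s) (vandermondeDet d)) = wronskDet n α := by
  rw [vandermondeDet_eq_sum, map_sum, map_sum, wronskDet, Matrix.det_apply]
  refine Finset.sum_congr rfl fun w _ => ?_
  rw [Units.smul_def, Units.smul_def, map_zsmul, map_zsmul, applyDiff_prod_X_pow,
    restitution_prod_C_mul_X_pow]
  rfl

theorem wronskDet_comp_perm {ι : Type*} (n : Fin d → ι) (α : Fin d → ℕ)
    (w : Equiv.Perm (Fin d)) :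
    wronskDet (n ∘ w) (α ∘ w) = (Equiv.Perm.sign w : ℤ) • wronskDet n α := by
  rw [zsmul_eq_mul, wronskDet, wronskDet, ← Matrix.det_permute']
  rfl

theorem wronskDet_mem_span_of_comp_perm {ι : Type*} {S : Submodule ℂ (MvPolynomial (ι × ℕ) ℂ)}
    {n : Fin d → ι} {α : Fin d → ℕ} (w : Equiv.Perm (Fin d))
    (h : wronskDet (n ∘ w) (α ∘ w) ∈ S) : wronskDet n α ∈ S := by
  have : wronskDet n α = (Equiv.Perm.sign w : ℤ) • wronskDet (n ∘ w) (α ∘ w) := by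
    rw [wronskDet_comp_perm, smul_smul, ← Units.val_mul, Int.units_mul_self, Units.val_one,
      one_smul]
  rw [this]
  exact zsmul_mem h _

theorem wronskDet_eq_Wpoly {N : ℕ} (D : WronskDatum N d) : wronskDet D.n D.a = Wpoly D := by
  rw [wronskDet, Wpoly]
  congr 1
  ext1 r s
  simp only [Matrix.of_apply]
  split_ifs with h
  · rw [Nat.descFactorial_eq_factorial_mul_choose, mul_comm (Nat.factorial _), smul_eq_C_mul]
  · rw [Nat.descFactorial_of_lt (not_le.1 h)]
    simp

theorem card_filter_comp_perm_le {κ : Type*} [LinearOrder κ] (n : Fin d → κ)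
    (w : Equiv.Perm (Fin d)) (i : κ) :
    (Finset.univ.filter fun t => (n ∘ w) t ≤ i).card =
      (Finset.univ.filter fun t => n t ≤ i).card :=
  Finset.card_equiv w fun t => by simp

theorem wronskDet_mem_span_of_bound {N : ℕ} (n : Fin d → Fin (N + 1)) (α : Fin d → ℕ)
    (h : ∀ s, α s < (Finset.univ.filter fun t => n t ≤ n s).card) :
    wronskDet n α ∈ Submodule.span ℂ (Set.range (Wpoly (N := N) (d := d))) := by
  let f : Fin d → Fin (N + 1) ×ₗ ℕ := fun s => toLex (n s, α s)
  by_cases hf : Function.Injective f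
  · let w := Tuple.sort f
    have hw : StrictMono (f ∘ w) :=
      (Tuple.monotone_sort f).strictMono_of_injective (hf.comp w.injective)
    refine wronskDet_mem_span_of_comp_perm w ?_
    let D : WronskDatum N d :=
      { n := n ∘ w
        a := α ∘ w
        mono := fun s t hst => by
          rcases (Prod.Lex.toLex_le_toLex.1 (hw.monotone hst)) with h1 | h1
          · exact h1.le
          · exact h1.1.le
        strictOnBlocks := fun s t hst hn => by
          rcases (Prod.Lex.toLex_lt_toLex.1 (hw hst)) with h1 | h1
          · exact absurd hn h1.ne
          · exact h1.2
        bound := fun s => by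
          rw [card_filter_comp_perm_le]
          exact h (w s) }
    exact Submodule.subset_span ⟨D, (wronskDet_eq_Wpoly D).symm⟩
  · simp only [Function.Injective, not_forall] at hf
    obtain ⟨s, t, hst, hne⟩ := hf
    have hst : (n s, α s) = (n t, α t) := hst
    rw [Prod.mk.injEq] at hst
    rw [wronskDet, Matrix.det_zero_of_column_eq hne fun r => by simp [hst.1, hst.2]]
    exact zero_mem _

theorem wronskDet_mem_span {N : ℕ} (n : Fin d → Fin (N + 1)) (α : Fin d → ℕ) :
    wronskDet n α ∈ Submodule.span ℂ (Set.range (Wpoly (N := N) (d := d))) := by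
  refine wronskDet_mem_span_of_comp_perm (Tuple.sort n) ?_
  have hn : Monotone (n ∘ Tuple.sort n) := Tuple.monotone_sort n
  generalize n ∘ Tuple.sort n = n' at hn
  generalize α ∘ Tuple.sort n = α'
  rw [← restitution_applyDiff_vandermondeDet]
  have h := isHarmonic_vandermondeDet.applyDiff_mem_span hn (∏ s, X s ^ α' s)
  generalize applyDiff (Fin d) (∏ s, X s ^ α' s) (vandermondeDet d) = G at h
  induction h using Submodule.span_induction with
  | zero => simp
  | add u v _ _ hu hv => rw [map_add]; exact add_mem hu hv
  | smul c u _ hu => rw [map_smul]; exact Submodule.smul_mem _ _ hu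
  | mem u hu =>
    obtain ⟨β, hβ, rfl⟩ := hu
    rw [restitution_applyDiff_vandermondeDet]
    exact wronskDet_mem_span_of_bound n' β hβ

theorem IsHarmonic.restitution_mem_span {N : ℕ} (n : Fin d → Fin (N + 1))
    {F : MvPolynomial (Fin d) ℂ} (hF : IsHarmonic F) :
    restitution n F ∈ Submodule.span ℂ (Set.range (Wpoly (N := N) (d := d))) := by
  obtain ⟨g, rfl⟩ := hF.exists_eq_applyDiff_vandermondeDet
  have h := isHarmonic_vandermondeDet.applyDiff_mem_span monotone_id g
  generalize _root_.applyDiff (Fin d) g (vandermondeDet d) = G at h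
  induction h using Submodule.span_induction with
  | zero => simp
  | add u v _ _ hu hv => rw [map_add]; exact add_mem hu hv
  | smul c u _ hu => rw [map_smul]; exact Submodule.smul_mem _ _ hu
  | mem u hu =>
    obtain ⟨β, -, rfl⟩ := hu
    rw [restitution_applyDiff_vandermondeDet]
    exact wronskDet_mem_span n β

theorem isDiffHom_wronskDet {N : ℕ} (n : Fin d → Fin (N + 1)) (α : Fin d → ℕ) :
    IsDiffHom N d (wronskDet n α) := by
  intro Q
  let L : Matrix (Fin d) (Fin d) (MvPolynomial (Fin (N + 1) × ℕ) (Polynomial ℂ)) :=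
    Matrix.of fun r k => C (((r : ℕ).choose k : Polynomial ℂ) *
      Polynomial.derivative^[(r : ℕ) - k] Q)
  have hL : L.det = C (Q ^ d) := by
    rw [Matrix.det_of_isLowerTriangular L]
    · simp [L]
    · intro i j hij
      have hij : i < j := hij
      simp [L, Nat.choose_eq_zero_of_lt (Fin.lt_def.1 hij)]
  rw [← hL, wronskDet, AlgHom.map_det, AlgHom.map_det, ← Matrix.det_mul]
  congr 1
  ext1 r s
  rw [Matrix.mul_apply]
  simp only [AlgHom.mapMatrix_apply, Matrix.map_apply, Matrix.of_apply, L, map_mul]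
  have hiotaX : ∀ p, iota N (X p) = X p := fun p => by simp [iota]
  simp only [hiotaX, map_natCast]
  let f : ℕ → MvPolynomial (Fin (N + 1) × ℕ) (Polynomial ℂ) := fun k =>
    ((r : ℕ).choose k : MvPolynomial (Fin (N + 1) × ℕ) (Polynomial ℂ)) *
      C (Polynomial.derivative^[(r : ℕ) - k] Q) *
      ((k.descFactorial (α s) : MvPolynomial (Fin (N + 1) × ℕ) (Polynomial ℂ)) *
        X (n s, k - α s))
  change _ = ∑ k : Fin d, f k
  rw [Fin.sum_univ_eq_sum_range f d]
  rcases le_or_gt (α s) r with h | h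
  · rw [← Finset.sum_subset (s₁ := Finset.Ico (α s) (r + 1)), Finset.sum_Ico_eq_sum_range, phi,
      aeval_X, Finset.mul_sum, Nat.sub_add_comm h]
    · refine Finset.sum_congr rfl fun j _ => ?_
      have hc := congrArg (Nat.cast (R := MvPolynomial (Fin (N + 1) × ℕ) (Polynomial ℂ)))
        (choose_mul_descFactorial_add (j := j) h)
      push_cast at hc
      simp only [f, Nat.add_sub_cancel_left, map_mul, map_natCast, Nat.sub_sub]
      linear_combination (-C (Polynomial.derivative^[(r : ℕ) - (α s + j)] Q) * X (n s, j)) * hc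
    · intro k hk
      have := (Finset.mem_Ico.1 hk).2
      exact Finset.mem_range.2 (by omega)
    · intro k _ hk
      rw [Finset.mem_Ico, not_and_or, not_le, not_lt] at hk
      rcases hk with hk | hk
      · simp [f, Nat.descFactorial_of_lt hk]
      · simp [f, Nat.choose_eq_zero_of_lt (show (r : ℕ) < k by omega)]
  · rw [Nat.descFactorial_of_lt h, Nat.cast_zero, zero_mul, Finset.sum_eq_zero]
    intro k _
    rcases lt_or_ge k (α s) with hk | hk
    · simp [f, Nat.descFactorial_of_lt hk]
    · simp [f, Nat.choose_eq_zero_of_lt (h.trans_le hk)]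

theorem eval_zero_iterate_derivative_linear (a b : ℂ) (m : ℕ) :
    Polynomial.eval 0 (Polynomial.derivative^[m] (Polynomial.C a + Polynomial.C b * Polynomial.X)) =
      if m = 0 then a else if m = 1 then b else 0 := by
  match m with
  | 0 => simp
  | 1 => simp
  | m + 2 => simp [Function.iterate_succ_apply]

theorem IsDiffHom.twist_eq {N : ℕ} {P : MvPolynomial (Fin (N + 1) × ℕ) ℂ}
    (hP : IsDiffHom N d P) (a b : ℂ) : twist a b P = a ^ d • P := by
  let ε : MvPolynomial (Fin (N + 1) × ℕ) (Polynomial ℂ) →ₐ[ℂ] MvPolynomial (Fin (N + 1) × ℕ) ℂ :=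
    mapAlgHom (Polynomial.aeval (0 : ℂ))
  have hεC : ∀ q : Polynomial ℂ, ε (C q) = C (Polynomial.eval 0 q) := fun q => by
    simp [ε]
  have hεX : ∀ p, ε (X p) = X p := fun p => by simp [ε]
  have hι : ε (iota N P) = P := by
    change (ε.comp (iota N)) P = AlgHom.id ℂ _ P
    congr 1
    ext1 p
    simp [ε, iota]
  set Q : Polynomial ℂ := Polynomial.C a + Polynomial.C b * Polynomial.X with hQ
  have hφ : ε (phi N Q P) = twist a b P := by
    change (ε.comp (phi N Q)) P = twist a b P
    congr 1
    ext1 ⟨i, k⟩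
    rw [AlgHom.comp_apply, phi, aeval_X, map_sum, twist, aeval_X]
    simp only [map_mul, map_natCast, hεC, hεX, hQ, eval_zero_iterate_derivative_linear]
    rw [Finset.sum_range_succ]
    cases k with
    | zero => simp
    | succ k =>
      rw [Finset.sum_range_succ, Finset.sum_eq_zero]
      · simp
        ring
      · intro j hj
        have := Finset.mem_range.1 hj
        rw [if_neg (by omega), if_neg (by omega)]
        simp
  have h := congrArg ε (hP Q)
  rw [hφ, map_mul, hι, hεC] at h
  rw [h, smul_eq_C_mul, hQ]
  simp

theorem IsDiffHom.degree_eq {N : ℕ} {P : MvPolynomial (Fin (N + 1) × ℕ) ℂ}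
    (hP : IsDiffHom N d P) {m : Fin (N + 1) × ℕ →₀ ℕ} (hm : m ∈ P.support) : m.degree = d := by
  have h := congrArg (coeff m) (hP.twist_eq 2 0)
  have h2 : (twist 2 0 : MvPolynomial (Fin (N + 1) × ℕ) ℂ →ₐ[ℂ] _) =
      aeval fun p => C 2 * X p := by
    ext1 p
    simp [twist]
  rw [h2, coeff_aeval_C_mul_X, coeff_smul, smul_eq_mul] at h
  have h3 := mul_right_cancel₀ (mem_support_iff.1 hm) h
  exact Nat.pow_right_injective le_rfl (by exact_mod_cast h3)

theorem IsDiffHom.isHarmonic_polarization {N : ℕ} {P : MvPolynomial (Fin (N + 1) × ℕ) ℂ}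
    (hP : IsDiffHom N d P) (n : Fin d → Fin (N + 1)) : IsHarmonic (polarization n P) := by
  intro c
  rw [← polarization_twist n c (mem_span_prod_X fun m hm => hP.degree_eq hm), hP.twist_eq,
    map_smul]

end Wronskian

/-- Every differentially homogeneous polynomial of degree `d` is a ℂ-linear combination of the
polynomials `W_𝒫`: `V_d^Diff` equals the ℂ-linear span of the family `(W_𝒫)_𝒫`. -/
theorem vdiff_eq_span_wronskians (N d : ℕ) (hN : 1 ≤ N) (hd : 1 ≤ d) :
    VDiff N d = Submodule.span ℂ (Set.range (Wpoly (N := N) (d := d))) := by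
  refine le_antisymm (fun P hP => ?_) (Submodule.span_le.2 ?_)
  · have hP : IsDiffHom N d P := hP
    have h := factorial_smul_eq_sum_restitution_polarization
      (mem_span_prod_X fun m hm => hP.degree_eq hm)
    rw [← inv_smul_smul₀ (Nat.cast_ne_zero.2 d.factorial_ne_zero : (d.factorial : ℂ) ≠ 0) P, h]
    exact Submodule.smul_mem _ _ (Submodule.sum_mem _ fun n _ =>
      (hP.isHarmonic_polarization n).restitution_mem_span n)
  · rintro _ ⟨D, rfl⟩
    rw [← wronskDet_eq_Wpoly]
    exact isDiffHom_wronskDet D.n D.a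
end

section
/- Fix integers N ≥ 1 and d ≥ 1, a function n : {1,…,d} → {0,…,N}, and polynomials R_1,…,R_d ∈ Polynomial ℂ. Let M be the d×d matrix over V whose entry in row r ∈ {0,…,d−1} and column s ∈ {1,…,d} is ∑_{j=0}^{r} (r choose j)·(R_s^{(r−j)}(0))·X_{n_s}^{(j)}, where R_s^{(m)}(0) denotes the value at 0 of the m-th formal derivative of R_s. Then det M is differentially homogeneous of degree d. -/
open MvPolynomial

/-- Iterated binomial convolutions commute. -/
theorem sum_choose_mul_sum_choose_comm {A : Type*} [CommSemiring A] (a b x : ℕ → A) (r : ℕ) :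
    ∑ k ∈ Finset.range (r + 1), (r.choose k * a (r - k)) *
        ∑ j ∈ Finset.range (k + 1), k.choose j * b (k - j) * x j =
      ∑ k ∈ Finset.range (r + 1), (r.choose k * b (r - k)) *
        ∑ j ∈ Finset.range (k + 1), k.choose j * a (k - j) * x j := by
  simp only [Finset.mul_sum]
  rw [Finset.sum_sigma', Finset.sum_sigma']
  refine Finset.sum_bij' (fun p _ => ⟨r + p.2 - p.1, p.2⟩) (fun p _ => ⟨r + p.2 - p.1, p.2⟩)
    ?_ ?_ ?_ ?_ ?_
  · rintro ⟨k, j⟩ h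
    simp only [Finset.mem_sigma, Finset.mem_range] at h ⊢
    omega
  · rintro ⟨k, j⟩ h
    simp only [Finset.mem_sigma, Finset.mem_range] at h ⊢
    omega
  · rintro ⟨k, j⟩ h
    simp only [Finset.mem_sigma, Finset.mem_range] at h
    simp only [Sigma.mk.injEq, heq_eq_eq, and_true]
    omega
  · rintro ⟨k, j⟩ h
    simp only [Finset.mem_sigma, Finset.mem_range] at h
    simp only [Sigma.mk.injEq, heq_eq_eq, and_true]
    omega
  · rintro ⟨k, j⟩ h
    simp only [Finset.mem_sigma, Finset.mem_range] at h
    have hchoose : r.choose k * k.choose j = r.choose (r + j - k) * (r + j - k).choose j := by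
      rw [Nat.choose_mul, Nat.choose_mul,
        ← Nat.choose_symm (show k - j ≤ r - j by omega)]
      · congr 2
        omega
      all_goals omega
    have h₁ : r - (r + j - k) = k - j := by omega
    have h₂ : r + j - k - j = r - k := by omega
    simp only [h₁, h₂]
    calc (r.choose k * a (r - k) * (k.choose j * b (k - j) * x j) : A)
        = ((r.choose k * k.choose j : ℕ) : A) * (a (r - k) * b (k - j) * x j) := by
          push_cast; ring
      _ = _ := by rw [hchoose]; push_cast; ring

/-- The lower triangular matrix of binomial multiples of derivatives of `Q`. -/
noncomputable def leibnizMatrix (σ : Type*) (d : ℕ) (Q : Polynomial ℂ) :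
    Matrix (Fin d) (Fin d) (MvPolynomial σ (Polynomial ℂ)) :=
  Matrix.of fun r k => ((r : ℕ).choose k : MvPolynomial σ (Polynomial ℂ)) *
    C (Polynomial.derivative^[(r : ℕ) - k] Q)

theorem det_leibnizMatrix (σ : Type*) (d : ℕ) (Q : Polynomial ℂ) :
    (leibnizMatrix σ d Q).det = C (Q ^ d) := by
  rw [Matrix.det_of_isLowerTriangular]
  · simp [leibnizMatrix]
  · intro i j hij
    have : (i : ℕ) < j := hij
    simp [leibnizMatrix, Nat.choose_eq_zero_of_lt this]

/-- Let `M` be the `d × d` matrix whose entry in row `r` and column `s` is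
`∑_{j=0}^{r} (r choose j) · R_s^{(r−j)}(0) · X_{n_s}^{(j)}`.  Then `det M` is differentially
homogeneous of degree `d`. -/
theorem det_wronskian_matrix_isDiffHom (N d : ℕ) (hN : 1 ≤ N) (hd : 1 ≤ d)
    (n : Fin d → Fin (N + 1)) (R : Fin d → Polynomial ℂ) :
    IsDiffHom N d (Matrix.det (Matrix.of fun r s : Fin d =>
      ∑ j ∈ Finset.range ((r : ℕ) + 1),
        (((r : ℕ).choose j : ℂ) * (Polynomial.derivative^[(r : ℕ) - j] (R s)).eval 0) •
          X (n s, j))) := by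
  intro Q
  rw [AlgHom.map_det, AlgHom.map_det, ← det_leibnizMatrix, ← Matrix.det_mul]
  congr 1
  ext1 r s
  rw [Matrix.mul_apply]
  set b : ℕ → MvPolynomial (Fin (N + 1) × ℕ) (Polynomial ℂ) := fun m =>
    C (Polynomial.C ((Polynomial.derivative^[m] (R s)).eval 0)) with hb
  set a : ℕ → MvPolynomial (Fin (N + 1) × ℕ) (Polynomial ℂ) := fun m =>
    C (Polynomial.derivative^[m] Q) with ha
  set x : ℕ → MvPolynomial (Fin (N + 1) × ℕ) (Polynomial ℂ) := fun j => X (n s, j) with hx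
  have hsmul (c : ℂ) (p : MvPolynomial (Fin (N + 1) × ℕ) (Polynomial ℂ)) :
      c • p = C (Polynomial.C c) * p := by
    rw [Algebra.smul_def]
    rfl
  have hphi : phi N Q (∑ j ∈ Finset.range ((r : ℕ) + 1),
      (((r : ℕ).choose j : ℂ) * (Polynomial.derivative^[(r : ℕ) - j] (R s)).eval 0) •
        X (n s, j)) = ∑ k ∈ Finset.range ((r : ℕ) + 1), ((r : ℕ).choose k * b (r - k)) *
        ∑ j ∈ Finset.range (k + 1), k.choose j * a (k - j) * x j := by
    simp [phi, hsmul, ha, hb, hx]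
  have hiota (k : ℕ) : iota N (∑ j ∈ Finset.range (k + 1),
      ((k.choose j : ℂ) * (Polynomial.derivative^[k - j] (R s)).eval 0) •
        X (n s, j)) = ∑ j ∈ Finset.range (k + 1), k.choose j * b (k - j) * x j := by
    simp [iota, hsmul, hb, hx]
  simp only [AlgHom.mapMatrix_apply, Matrix.map_apply, Matrix.of_apply, hphi, hiota,
    leibnizMatrix]
  rw [sum_choose_mul_sum_choose_comm, Fin.sum_univ_eq_sum_range (fun k =>
    ((r : ℕ).choose k * a (r - k)) *
      ∑ j ∈ Finset.range (k + 1), k.choose j * b (k - j) * x j) d]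
  refine Finset.sum_subset (Finset.range_subset_range.2 r.2) fun k _ hk => ?_
  rw [Nat.choose_eq_zero_of_lt (by simpa using hk)]
  simp
end

section
/- For all integers N ≥ 1 and d ≥ 1: the set of Wronskian data 𝒫 of degree d is finite of cardinality (N+1)^d, and the family (W_𝒫)_𝒫 indexed by it is linearly independent over ℂ in V. -/
open MvPolynomial

/-- Finite sets of pairs `(letter, exponent)` of size `d` satisfying the bound of a Wronskian
datum. -/
def wronskFinsets (N d : ℕ) : Set (Finset (Fin (N + 1) × ℕ)) :=
  {S | S.card = d ∧ ∀ x ∈ S, x.2 < (S.filter fun y => y.1 ≤ x.1).card}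

/-- Add one to the exponents of all letters which are at least `c`. -/
def shiftFrom {N : ℕ} (c : Fin (N + 1)) (x : Fin (N + 1) × ℕ) : Fin (N + 1) × ℕ :=
  (x.1, if x.1 < c then x.2 else x.2 + 1)

lemma shiftFrom_injective {N : ℕ} (c : Fin (N + 1)) : Function.Injective (shiftFrom c) := by
  rintro ⟨i, a⟩ ⟨j, b⟩ h
  simp only [shiftFrom, Prod.mk.injEq] at h
  obtain ⟨rfl, h⟩ := h
  split_ifs at h <;> simp_all

/-- Prepend the letter `c` to the word encoded by a finite set of pairs. -/
def consLetter {N : ℕ} (c : Fin (N + 1)) (S : Finset (Fin (N + 1) × ℕ)) :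
    Finset (Fin (N + 1) × ℕ) :=
  insert (c, 0) (S.image (shiftFrom c))

lemma shiftFrom_snd_pos {N : ℕ} {c : Fin (N + 1)} {x : Fin (N + 1) × ℕ} (h : c ≤ x.1) :
    (shiftFrom c x).2 ≠ 0 := by
  simp [shiftFrom, not_lt.2 h]

lemma notMem_image_shiftFrom {N : ℕ} (c : Fin (N + 1)) (S : Finset (Fin (N + 1) × ℕ)) :
    (c, 0) ∉ S.image (shiftFrom c) := by
  intro h
  obtain ⟨x, -, hx⟩ := Finset.mem_image.1 h
  have h1 : x.1 = c := congrArg Prod.fst hx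
  exact shiftFrom_snd_pos h1.ge (congrArg Prod.snd hx)

lemma card_consLetter {N : ℕ} (c : Fin (N + 1)) (S : Finset (Fin (N + 1) × ℕ)) :
    (consLetter c S).card = S.card + 1 := by
  rw [consLetter, Finset.card_insert_of_notMem (notMem_image_shiftFrom c S),
    Finset.card_image_of_injective _ (shiftFrom_injective c)]

lemma card_filter_consLetter {N : ℕ} (c i : Fin (N + 1)) (S : Finset (Fin (N + 1) × ℕ)) :
    ((consLetter c S).filter fun y => y.1 ≤ i).card =
      (S.filter fun y => y.1 ≤ i).card + if i < c then 0 else 1 := by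
  have himage : ((S.image (shiftFrom c)).filter fun y => y.1 ≤ i).card =
      (S.filter fun y => y.1 ≤ i).card := by
    rw [Finset.filter_image, Finset.card_image_of_injective _ (shiftFrom_injective c)]
    rfl
  rw [consLetter, Finset.filter_insert]
  split_ifs with h1 h2 h2
  · exact absurd h1 (not_le.2 h2)
  · rw [Finset.card_insert_of_notMem, himage]
    exact fun h => notMem_image_shiftFrom c S (Finset.mem_filter.1 h).1
  · rw [himage, add_zero]
  · exact absurd (not_lt.1 h2) h1

lemma consLetter_bound_iff {N : ℕ} (c : Fin (N + 1)) (S : Finset (Fin (N + 1) × ℕ)) :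
    (∀ x ∈ consLetter c S, x.2 < ((consLetter c S).filter fun y => y.1 ≤ x.1).card) ↔
      ∀ x ∈ S, x.2 < (S.filter fun y => y.1 ≤ x.1).card := by
  simp only [card_filter_consLetter]
  rw [consLetter, Finset.forall_mem_insert, Finset.forall_mem_image]
  simp only [lt_irrefl, if_false, Nat.succ_pos, true_and]
  refine forall₂_congr fun x _ => ?_
  change (if x.1 < c then x.2 else x.2 + 1) <
    (S.filter fun y => y.1 ≤ x.1).card + (if x.1 < c then 0 else 1) ↔ _
  split_ifs <;> simp

lemma consLetter_mem_iff {N d : ℕ} (c : Fin (N + 1)) (S : Finset (Fin (N + 1) × ℕ)) :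
    consLetter c S ∈ wronskFinsets N (d + 1) ↔ S ∈ wronskFinsets N d := by
  simp only [wronskFinsets, Set.mem_ofPred_eq, consLetter_bound_iff, card_consLetter,
    Nat.add_right_cancel_iff]

lemma le_of_mk_zero_mem_consLetter {N : ℕ} {c i : Fin (N + 1)}
    {S : Finset (Fin (N + 1) × ℕ)} (h : (i, 0) ∈ consLetter c S) : i ≤ c := by
  rcases Finset.mem_insert.1 h with h | h
  · exact (congrArg Prod.fst h).le
  · obtain ⟨x, -, hx⟩ := Finset.mem_image.1 h
    by_contra! hc
    have h1 : x.1 = i := congrArg Prod.fst hx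
    exact shiftFrom_snd_pos (h1 ▸ hc.le) (congrArg Prod.snd hx)

lemma consLetter_injective {N : ℕ} {c c' : Fin (N + 1)} {S S' : Finset (Fin (N + 1) × ℕ)}
    (h : consLetter c S = consLetter c' S') : c = c' ∧ S = S' := by
  have hc : c = c' := le_antisymm
    (le_of_mk_zero_mem_consLetter (h.subset (Finset.mem_insert_self _ _)))
    (le_of_mk_zero_mem_consLetter (h.superset (Finset.mem_insert_self _ _)))
  subst hc
  refine ⟨rfl, Finset.image_injective (shiftFrom_injective c) ?_⟩
  rw [← Finset.erase_insert (notMem_image_shiftFrom c S),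
    ← Finset.erase_insert (notMem_image_shiftFrom c S')]
  exact congrArg (fun T => T.erase (c, 0)) h

lemma exists_mk_zero_mem {N d : ℕ} {S : Finset (Fin (N + 1) × ℕ)}
    (hS : S ∈ wronskFinsets N (d + 1)) : ∃ i, (i, 0) ∈ S := by
  obtain ⟨x, hx, hmin⟩ := S.exists_min_image Prod.fst
    (Finset.card_pos.1 (hS.1 ▸ Nat.succ_pos d))
  by_contra! h0
  set F := S.filter fun y => y.1 ≤ x.1 with hF
  have hfst : ∀ y ∈ F, y.1 = x.1 := fun y hy =>
    le_antisymm (Finset.mem_filter.1 hy).2 (hmin y (Finset.mem_filter.1 hy).1)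
  have hle : F.card ≤ (Finset.Ioo 0 F.card).card := by
    refine Finset.card_le_card_of_injOn Prod.snd (fun y hy => ?_) fun y hy z hz hyz => ?_
    · have hyS := (Finset.mem_filter.1 hy).1
      have hb := hS.2 y hyS
      rw [hfst y hy] at hb
      refine Finset.mem_coe.2 (Finset.mem_Ioo.2 ⟨Nat.pos_of_ne_zero fun hz => ?_, hb⟩)
      exact h0 y.1 (hz ▸ hyS)
    · exact Prod.ext ((hfst y hy).trans (hfst z hz).symm) hyz
  have hpos : 0 < F.card := Finset.card_pos.2 ⟨x, Finset.mem_filter.2 ⟨hx, le_rfl⟩⟩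
  rw [Nat.card_Ioo] at hle
  omega

lemma exists_eq_consLetter {N d : ℕ} {S : Finset (Fin (N + 1) × ℕ)}
    (hS : S ∈ wronskFinsets N (d + 1)) : ∃ c T, consLetter c T = S := by
  obtain ⟨i, hi⟩ := exists_mk_zero_mem hS
  obtain ⟨c, hc, hmax⟩ := (Finset.univ.filter fun i => (i, 0) ∈ S).exists_max_image id
    ⟨i, by simpa using hi⟩
  simp only [Finset.mem_filter, Finset.mem_univ, true_and, id] at hc hmax
  refine ⟨c, (S.erase (c, 0)).image fun x => (x.1, if x.1 < c then x.2 else x.2 - 1), ?_⟩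
  rw [consLetter, Finset.image_image, Finset.image_congr (g := id), Finset.image_id,
    Finset.insert_erase hc]
  rintro ⟨j, a⟩ hx
  simp only [Finset.coe_erase, Set.mem_sdiff, Finset.mem_coe, Set.mem_singleton_iff,
    Prod.mk.injEq, not_and] at hx
  obtain ⟨hx, hne⟩ := hx
  simp only [shiftFrom, Function.comp, id, Prod.mk.injEq, true_and]
  split_ifs with h
  · rfl
  · refine Nat.sub_add_cancel (Nat.pos_of_ne_zero ?_)
    rintro rfl
    exact hne (le_antisymm (hmax j hx) (not_lt.1 h)) rfl

lemma card_wronskFinsets (N d : ℕ) : Nat.card (wronskFinsets N d) = (N + 1) ^ d := by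
  induction d with
  | zero =>
    have : wronskFinsets N 0 = {∅} := by
      ext S
      simp only [wronskFinsets, Set.mem_ofPred_eq, Finset.card_eq_zero, Set.mem_singleton_iff,
        and_iff_left_iff_imp]
      rintro rfl
      simp
    rw [this]
    simp
  | succ d ih =>
    let f : Fin (N + 1) × wronskFinsets N d → wronskFinsets N (d + 1) := fun p =>
      ⟨consLetter p.1 p.2, (consLetter_mem_iff _ _).2 p.2.2⟩
    have hf : Function.Bijective f := by
      refine ⟨fun p q h => ?_, fun S => ?_⟩
      · obtain ⟨h1, h2⟩ := consLetter_injective (congrArg Subtype.val h)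
        exact Prod.ext h1 (Subtype.ext h2)
      · obtain ⟨c, T, hT⟩ := exists_eq_consLetter S.2
        exact ⟨(c, ⟨T, (consLetter_mem_iff c T).1 (hT ▸ S.2)⟩), Subtype.ext hT⟩
    rw [← Nat.card_congr (Equiv.ofBijective f hf), Nat.card_prod, ih, Nat.card_fin, pow_succ']

namespace WronskDatum

variable {N d : ℕ}

/-- The column labels `(n_s, α_s)` in lexicographic order. -/
def label (D : WronskDatum N d) (s : Fin d) : Fin (N + 1) ×ₗ ℕ := toLex (D.n s, D.a s)

lemma label_strictMono (D : WronskDatum N d) : StrictMono D.label := by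
  intro s t hst
  rw [label, label, Prod.Lex.toLex_lt_toLex]
  rcases (D.mono hst.le).lt_or_eq with h | h
  · exact Or.inl h
  · exact Or.inr ⟨h, D.strictOnBlocks s t hst h⟩

lemma label_injective : Function.Injective (label : WronskDatum N d → _) := by
  rintro ⟨n, a, _, _, _⟩ ⟨n', a', _, _, _⟩ h
  have h' : ∀ s, n s = n' s ∧ a s = a' s := fun s => by
    simpa [label] using congrFun h s
  obtain rfl : n = n' := funext fun s => (h' s).1
  obtain rfl : a = a' := funext fun s => (h' s).2
  rfl

lemma card_eq : Nat.card (WronskDatum N d) = (N + 1) ^ d := by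
  have hinj : ∀ D : WronskDatum N d, Function.Injective fun s => (D.n s, D.a s) :=
    fun D s t h => D.label_strictMono.injective (congrArg toLex h)
  let f : WronskDatum N d → wronskFinsets N d := fun D =>
    ⟨Finset.univ.image fun s => (D.n s, D.a s), by
      refine ⟨by rw [Finset.card_image_of_injective _ (hinj D), Finset.card_fin], ?_⟩
      rw [Finset.forall_mem_image]
      intro s _
      rw [Finset.filter_image, Finset.card_image_of_injective _ (hinj D)]
      exact D.bound s⟩
  have hf : Function.Bijective f := by
    refine ⟨fun D E h => label_injective ?_, fun S => ?_⟩
    · refine (D.label_strictMono.range_inj E.label_strictMono).1 ?_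
      have h1 : Set.range (fun s => (D.n s, D.a s)) = Set.range fun s => (E.n s, E.a s) := by
        simpa [f] using congrArg (fun T : wronskFinsets N d => (T.1 : Set (Fin (N + 1) × ℕ))) h
      have h2 := congrArg (fun T => toLex '' T) h1
      rw [← Set.range_comp, ← Set.range_comp] at h2
      exact h2
    · let T : Finset (Fin (N + 1) ×ₗ ℕ) := S.1.map toLex.toEmbedding
      have hT : T.card = d := by rw [Finset.card_map]; exact S.2.1
      let e := T.orderEmbOfFin hT
      have himage : Finset.univ.image (fun s => ofLex (e s)) = S.1 := by
        have h := congrArg (Finset.map ofLex.toEmbedding) (Finset.image_orderEmbOfFin_univ T hT)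
        rw [Finset.map_map, Finset.map_eq_image, Finset.image_image] at h
        exact h.trans (Finset.map_refl (s := S.1))
      have hei : Function.Injective fun s => ofLex (e s) := ofLex.injective.comp e.injective
      refine ⟨⟨fun s => (ofLex (e s)).1, fun s => (ofLex (e s)).2, fun s t hst => ?_,
        fun s t hst h => ?_, fun s => ?_⟩, Subtype.ext himage⟩
      · exact Prod.Lex.monotone_fst _ _ (e.monotone hst)
      · rcases Prod.Lex.lt_iff.1 (e.strictMono hst) with h' | h'
        · exact absurd h h'.ne
        · exact h'.2
      · have hb := S.2.2 (ofLex (e s)) (himage ▸ Finset.mem_image_of_mem _ (Finset.mem_univ s))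
        rw [← himage, Finset.filter_image, Finset.card_image_of_injective _ hei] at hb
        exact hb
  rw [Nat.card_congr (Equiv.ofBijective f hf), card_wronskFinsets]

lemma a_le (D : WronskDatum N d) (s : Fin d) : D.a s ≤ s := by
  suffices h : ∀ k : ℕ, ∀ s : Fin d, (s : ℕ) + k + 1 = d → D.a s ≤ s from
    h (d - 1 - s) s (by omega)
  intro k
  induction k with
  | zero =>
    intro s hs
    have := (D.bound s).trans_le (Finset.card_le_univ _)
    rw [Fintype.card_fin] at this
    omega
  | succ k ih =>
    intro s hs
    let t : Fin d := ⟨s + 1, by omega⟩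
    have hst : s < t := Fin.lt_def.2 (Nat.lt_succ_self _)
    rcases (D.mono hst.le).lt_or_eq with h | h
    · have hsub : (Finset.univ.filter fun u => D.n u ≤ D.n s) ⊆ Finset.Iic s := by
        intro u hu
        rw [Finset.mem_filter] at hu
        rw [Finset.mem_Iic]
        by_contra! hsu
        have htu : t ≤ u := Fin.le_def.2 (Nat.succ_le_of_lt hsu)
        exact absurd (h.trans_le (D.mono htu)) (not_lt.2 hu.2)
      have := (D.bound s).trans_le (Finset.card_le_card hsub)
      rw [Fin.card_Iic] at this
      omega
    · have h1 := D.strictOnBlocks s t hst h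
      have h2 : D.a t ≤ s + 1 := ih t (by simp only [t]; omega)
      omega

/-- The exponent of the monomial contributed by the permutation `σ` to the determinant `W_𝒫`. -/
noncomputable def permExponent (D : WronskDatum N d) (σ : Equiv.Perm (Fin d)) :
    Fin (N + 1) × ℕ →₀ ℕ :=
  ∑ s, Finsupp.single (D.n s, (σ s : ℕ) - D.a s) 1

/-- The labels of the variables on the diagonal, ordered so that they are nondecreasing. -/
def diagLabel (D : WronskDatum N d) (s : Fin d) : Fin (N + 1) ×ₗ ℕᵒᵈ :=
  toLex (D.n s, OrderDual.toDual ((s : ℕ) - D.a s))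

lemma a_add_le (D : WronskDatum N d) {s t : Fin d} (hst : s ≤ t) (h : D.n s = D.n t) :
    D.a s + (t - s) ≤ D.a t := by
  suffices H : ∀ k : ℕ, ∀ t : Fin d, (t : ℕ) = s + k → D.n s = D.n t → D.a s + k ≤ D.a t from
    H (t - s) t (by have := Fin.le_def.1 hst; omega) h
  intro k
  induction k with
  | zero =>
    intro t ht _
    obtain rfl : t = s := Fin.ext ht
    rfl
  | succ k ih =>
    intro t ht hn
    let u : Fin d := ⟨s + k, by omega⟩
    have hut : u < t := Fin.lt_def.2 (by simp only [u]; omega)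
    have hsu : s ≤ u := Fin.le_def.2 (Nat.le_add_right _ _)
    have hnu : D.n s = D.n u := le_antisymm (D.mono hsu) (hn ▸ D.mono hut.le)
    have h1 := ih u rfl hnu
    have h2 := D.strictOnBlocks u t hut (hnu ▸ hn)
    omega

lemma diagLabel_monotone (D : WronskDatum N d) : Monotone D.diagLabel := by
  intro s t hst
  rw [diagLabel, diagLabel, Prod.Lex.toLex_le_toLex]
  rcases (D.mono hst).lt_or_eq with h | h
  · exact Or.inl h
  · refine Or.inr ⟨h, ?_⟩
    have := D.a_add_le hst h
    have := Fin.le_def.1 hst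
    simp only [OrderDual.toDual_le_toDual]
    omega

lemma permExponent_one_injective :
    Function.Injective fun D : WronskDatum N d => D.permExponent 1 := by
  intro D E h
  let f : Fin (N + 1) ×ₗ ℕᵒᵈ → Fin (N + 1) × ℕ := fun x =>
    ((ofLex x).1, OrderDual.ofDual (ofLex x).2)
  have hf : Function.Injective f := fun x y hxy => hxy
  have key : ∀ F : WronskDatum N d, Finsupp.toMultiset (F.permExponent 1) =
      (List.ofFn F.diagLabel : Multiset (Fin (N + 1) ×ₗ ℕᵒᵈ)).map f := by
    intro F
    rw [permExponent, map_sum, ← Fin.univ_val_map, Multiset.map_map,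
      ← Multiset.sum_map_singleton (Multiset.map _ _), Multiset.map_map]
    refine Finset.sum_congr rfl fun s _ => ?_
    rw [Finsupp.toMultiset_single, one_smul]
    rfl
  have hmap := congrArg Finsupp.toMultiset h
  simp only [key] at hmap
  have hperm : (List.ofFn D.diagLabel).Perm (List.ofFn E.diagLabel) :=
    Multiset.coe_eq_coe.1 (Multiset.map_injective hf hmap)
  have hlabel : D.diagLabel = E.diagLabel := List.ofFn_injective
    (hperm.eq_of_sortedLE D.diagLabel_monotone.sortedLE_ofFn E.diagLabel_monotone.sortedLE_ofFn)
  refine label_injective (funext fun s => ?_)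
  have hs := congrFun hlabel s
  simp only [diagLabel, EmbeddingLike.apply_eq_iff_eq, Prod.mk.injEq] at hs
  have := D.a_le s
  have := E.a_le s
  rw [label, label, hs.1, show D.a s = E.a s by omega]

/-- The weights of the variables for which the diagonal of `W_𝒫` is the leading term. -/
def varWeight (N d : ℕ) (v : Fin (N + 1) × ℕ) : ℤ :=
  2 * d * (v.1 : ℕ) * v.2 - (v.2 : ℤ) ^ 2

lemma weight_permExponent (D : WronskDatum N d) {σ : Equiv.Perm (Fin d)}
    (hσ : ∀ s, D.a s ≤ σ s) :
    Finsupp.weight (varWeight N d) (D.permExponent σ) =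
      2 * ∑ s, ((d * (D.n s : ℕ) + D.a s : ℕ) : ℤ) * ((σ s : ℕ) : ℤ) -
        ∑ s, (2 * d * (D.n s : ℕ) * D.a s + (D.a s : ℤ) ^ 2) - ∑ s : Fin d, ((s : ℕ) : ℤ) ^ 2 := by
  rw [← Equiv.sum_comp σ fun s : Fin d => ((s : ℕ) : ℤ) ^ 2, permExponent, map_sum,
    Finset.mul_sum, ← Finset.sum_sub_distrib, ← Finset.sum_sub_distrib]
  refine Finset.sum_congr rfl fun s _ => ?_
  rw [Finsupp.weight_single, one_smul, varWeight]
  push_cast [Nat.cast_sub (hσ s)]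
  ring

lemma weight_permExponent_lt (D : WronskDatum N d) {σ : Equiv.Perm (Fin d)}
    (hσ : ∀ s, D.a s ≤ σ s) (hne : σ ≠ 1) :
    Finsupp.weight (varWeight N d) (D.permExponent σ) <
      Finsupp.weight (varWeight N d) (D.permExponent 1) := by
  rw [D.weight_permExponent hσ, D.weight_permExponent (σ := 1) D.a_le]
  have hf : StrictMono fun s => ((d * (D.n s : ℕ) + D.a s : ℕ) : ℤ) := by
    intro s t hst
    simp only [Nat.cast_lt]
    rcases (D.mono hst.le).lt_or_eq with h | h
    · have h1 := Nat.mul_le_mul_left d (Nat.succ_le_of_lt (Fin.lt_def.1 h))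
      have h2 := D.a_le s
      have h3 := s.2
      rw [Nat.succ_eq_add_one, mul_add, mul_one] at h1
      omega
    · rw [h]
      have := D.strictOnBlocks s t hst h
      omega
  have hg : StrictMono fun s : Fin d => ((s : ℕ) : ℤ) := fun s t hst => by
    simpa using hst
  have hlt := (hf.monotone.monovary hg.monotone).sum_mul_comp_perm_lt_sum_mul_iff (σ := σ) |>.2 <| by
    intro hmono
    refine hne (σ.monotone_iff.1 fun s t hst => ?_)
    by_contra! hlt
    have hts := hf.le_iff_le.1 (hmono (hg hlt))
    rw [le_antisymm hst hts] at hlt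
    exact lt_irrefl _ hlt
  simp only [Equiv.Perm.one_apply]
  linarith

lemma prod_entries (D : WronskDatum N d) (σ : Equiv.Perm (Fin d)) :
    (∏ s, (if D.a s ≤ (σ s : ℕ) then
      (((σ s : ℕ).choose (D.a s) * (D.a s).factorial : ℕ) : ℂ) •
        (X (D.n s, (σ s : ℕ) - D.a s) : MvPolynomial (Fin (N + 1) × ℕ) ℂ) else 0)) =
      if ∀ s, D.a s ≤ σ s then
        monomial (D.permExponent σ)
          (∏ s, (((σ s : ℕ).choose (D.a s) * (D.a s).factorial : ℕ) : ℂ))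
      else 0 := by
  split_ifs with h
  · rw [permExponent, monomial_sum_prod]
    refine Finset.prod_congr rfl fun s _ => ?_
    rw [if_pos (h s), X, smul_monomial, smul_eq_mul, mul_one]
  · push Not at h
    obtain ⟨s, hs⟩ := h
    exact Finset.prod_eq_zero (Finset.mem_univ s) (if_neg (not_le.2 hs))

lemma coeff_Wpoly (D : WronskDatum N d) (m : Fin (N + 1) × ℕ →₀ ℕ) :
    coeff m (Wpoly D) = ∑ σ : Equiv.Perm (Fin d), Equiv.Perm.sign σ •
      if (∀ s, D.a s ≤ σ s) ∧ D.permExponent σ = m then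
        ∏ s, (((σ s : ℕ).choose (D.a s) * (D.a s).factorial : ℕ) : ℂ) else 0 := by
  rw [Wpoly, Matrix.det_apply, coeff_sum]
  refine Finset.sum_congr rfl fun σ _ => ?_
  simp only [Matrix.of_apply, prod_entries, ite_and]
  rw [Units.smul_def, Units.smul_def, coeff_smul]
  split_ifs with h1 h2
  · rw [h2, coeff_monomial, if_pos rfl]
  · rw [coeff_monomial, if_neg h2]
  · rw [coeff_zero]

lemma coeff_Wpoly_diag (D : WronskDatum N d) : coeff (D.permExponent 1) (Wpoly D) ≠ 0 := by
  rw [coeff_Wpoly, Finset.sum_eq_single 1]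
  · rw [if_pos ⟨D.a_le, rfl⟩, Equiv.Perm.sign_one, one_smul, Finset.prod_ne_zero_iff]
    intro s _
    exact_mod_cast mul_ne_zero (Nat.choose_pos (D.a_le s)).ne' (Nat.factorial_ne_zero _)
  · intro σ _ hne
    rw [if_neg, smul_zero]
    rintro ⟨h, heq⟩
    exact (D.weight_permExponent_lt h hne).ne (congrArg _ heq)
  · exact fun h => absurd (Finset.mem_univ _) h

lemma coeff_Wpoly_eq_zero {D E : WronskDatum N d} (hne : E ≠ D)
    (hle : Finsupp.weight (varWeight N d) (E.permExponent 1) ≤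
      Finsupp.weight (varWeight N d) (D.permExponent 1)) :
    coeff (D.permExponent 1) (Wpoly E) = 0 := by
  rw [coeff_Wpoly]
  refine Finset.sum_eq_zero fun σ _ => ?_
  rw [if_neg, smul_zero]
  rintro ⟨h, heq⟩
  by_cases hσ : σ = 1
  · subst hσ
    exact hne (permExponent_one_injective heq)
  · exact ((E.weight_permExponent_lt h hσ).trans_le hle).ne (congrArg _ heq)

lemma linearIndependent_Wpoly :
    LinearIndependent ℂ fun D : WronskDatum N d => Wpoly D := by
  rw [linearIndependent_iff']
  intro T g hsum
  by_contra! hne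
  obtain ⟨D₀, hD₀, hg₀⟩ := hne
  classical
  obtain ⟨D, hD, hmax⟩ := (T.filter fun D => g D ≠ 0).exists_max_image
    (fun D => Finsupp.weight (varWeight N d) (D.permExponent 1))
    ⟨D₀, Finset.mem_filter.2 ⟨hD₀, hg₀⟩⟩
  rw [Finset.mem_filter] at hD
  have hcoeff := congrArg (coeff (D.permExponent 1)) hsum
  rw [coeff_sum, Finset.sum_eq_single_of_mem D hD.1, coeff_smul, coeff_zero, smul_eq_mul] at hcoeff
  · exact (mul_ne_zero hD.2 D.coeff_Wpoly_diag) hcoeff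
  · intro E hE hED
    rw [coeff_smul, smul_eq_mul]
    by_cases hgE : g E = 0
    · rw [hgE, zero_mul]
    · rw [coeff_Wpoly_eq_zero hED (hmax E (Finset.mem_filter.2 ⟨hE, hgE⟩)), mul_zero]

end WronskDatum

/-- The set of Wronskian data of degree `d` is finite of cardinality `(N+1)^d`, and the family
`(W_𝒫)_𝒫` indexed by it is linearly independent over ℂ. -/
theorem wronskians_card_and_linearIndependent (N d : ℕ) (hN : 1 ≤ N) (hd : 1 ≤ d) :
    Finite (WronskDatum N d) ∧
      Nat.card (WronskDatum N d) = (N + 1) ^ d ∧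
      LinearIndependent ℂ (fun D : WronskDatum N d => Wpoly D) := by
  have hcard : Nat.card (WronskDatum N d) = (N + 1) ^ d := WronskDatum.card_eq
  exact ⟨Nat.finite_of_card_ne_zero (hcard ▸ pow_ne_zero d N.succ_ne_zero), hcard,
    WronskDatum.linearIndependent_Wpoly⟩
end

section
/- Let N ≥ 1 and d ≥ 1 be integers, let A be an invertible (N+1)×(N+1) complex matrix, and let P ∈ V be differentially homogeneous of degree d. Then A·P is differentially homogeneous of degree d; moreover, for any k ∈ ℕ, if P has order at most k then A·P has order at most k. -/
open MvPolynomial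

/-- The action of a matrix `A` on `V`, substituting `X_i^{(k)} ↦ ∑_{j} A_{ij} · X_j^{(k)}`. -/
noncomputable def matAct (N : ℕ) (A : Matrix (Fin (N + 1)) (Fin (N + 1)) ℂ) :
    MvPolynomial (Fin (N + 1) × ℕ) ℂ →ₐ[ℂ] MvPolynomial (Fin (N + 1) × ℕ) ℂ :=
  aeval fun p => ∑ j, C (A p.1 j) * X (j, p.2)

/-- The extension of `matAct N A` to coefficients in `Polynomial ℂ`. -/
noncomputable def matActPoly (N : ℕ) (A : Matrix (Fin (N + 1)) (Fin (N + 1)) ℂ) :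
    MvPolynomial (Fin (N + 1) × ℕ) (Polynomial ℂ) →ₐ[Polynomial ℂ]
      MvPolynomial (Fin (N + 1) × ℕ) (Polynomial ℂ) :=
  aeval fun p => ∑ j, C (Polynomial.C (A p.1 j)) * X (j, p.2)

theorem phi_matAct (N : ℕ) (Q : Polynomial ℂ) (A : Matrix (Fin (N + 1)) (Fin (N + 1)) ℂ)
    (P : MvPolynomial (Fin (N + 1) × ℕ) ℂ) :
    phi N Q (matAct N A P) = matActPoly N A (phi N Q P) := by
  have h : (phi N Q).comp (matAct N A) =
      ((matActPoly N A).restrictScalars ℂ).comp (phi N Q) := by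
    ext1 p
    have hC (a : ℂ) : algebraMap ℂ (MvPolynomial (Fin (N + 1) × ℕ) (Polynomial ℂ)) a =
        C (Polynomial.C a) := rfl
    have hC' (a : Polynomial ℂ) : matActPoly N A (C a) = C a := algHom_C _ _
    simp only [AlgHom.comp_apply, AlgHom.restrictScalars_apply, matAct, phi, aeval_X, map_sum,
      map_mul, algHom_C, hC, hC', Finset.mul_sum]
    simp only [matActPoly, aeval_X, Finset.mul_sum]
    rw [Finset.sum_comm]
    exact Finset.sum_congr rfl fun _ _ => Finset.sum_congr rfl fun _ _ => by ring
  exact DFunLike.congr_fun h P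

theorem iota_matAct (N : ℕ) (A : Matrix (Fin (N + 1)) (Fin (N + 1)) ℂ)
    (P : MvPolynomial (Fin (N + 1) × ℕ) ℂ) :
    iota N (matAct N A P) = matActPoly N A (iota N P) := by
  have h : (iota N).comp (matAct N A) =
      ((matActPoly N A).restrictScalars ℂ).comp (iota N) := by
    ext1 p
    have hC (a : ℂ) : algebraMap ℂ (MvPolynomial (Fin (N + 1) × ℕ) (Polynomial ℂ)) a =
        C (Polynomial.C a) := rfl
    have hX (q : Fin (N + 1) × ℕ) : iota N (X q) = X q := map_X _ _
    simp only [AlgHom.comp_apply, AlgHom.restrictScalars_apply, matAct, matActPoly, aeval_X,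
      map_sum, map_mul, algHom_C, hC, hX]
  exact DFunLike.congr_fun h P

theorem exists_mem_vars_of_mem_vars_matAct {N : ℕ}
    {A : Matrix (Fin (N + 1)) (Fin (N + 1)) ℂ} {P : MvPolynomial (Fin (N + 1) × ℕ) ℂ}
    {p : Fin (N + 1) × ℕ} (hp : p ∈ (matAct N A P).vars) : ∃ q ∈ P.vars, p.2 = q.2 := by
  classical
  obtain ⟨q, hq, hpq⟩ := mem_vars_bind₁ _ P hp
  refine ⟨q, hq, ?_⟩
  obtain ⟨j, -, hj⟩ := Finset.mem_biUnion.1 (vars_sum_subset _ _ hpq)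
  have hp : p = (j, q.2) := by simpa using vars_mul _ _ hj
  rw [hp]

/-- If `A` is invertible and `P` is differentially homogeneous of degree `d`, then `A·P` is
differentially homogeneous of degree `d`; moreover if `P` has order at most `k`, so does `A·P`. -/
theorem matAct_isDiffHom (N d : ℕ) (hN : 1 ≤ N) (hd : 1 ≤ d)
    (A : Matrix (Fin (N + 1)) (Fin (N + 1)) ℂ) (hA : IsUnit A)
    (P : MvPolynomial (Fin (N + 1) × ℕ) ℂ) (hP : IsDiffHom N d P) :
    IsDiffHom N d (matAct N A P) ∧
      ∀ k : ℕ, (∀ p ∈ P.vars, p.2 ≤ k) → ∀ p ∈ (matAct N A P).vars, p.2 ≤ k := by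
  refine ⟨fun Q => ?_, fun k hk p hp => ?_⟩
  · rw [phi_matAct, hP Q, map_mul, algHom_C, iota_matAct]
    rfl
  · obtain ⟨q, hq, h⟩ := exists_mem_vars_of_mem_vars_matAct hp
    exact h ▸ hk q hq
end
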